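/- Multipoint Schwarz–Pick Lemma: let n ≥ 1, let p, p₁, …, pₙ ∈ 𝔹, and let f be a slice regular self-map of 𝔹 which is not a regular Blaschke product of degree ≤ n. Then for every q ∈ 𝔹, |(ℳ_{f^{⟨n⟩}_{p₁,…,pₙ}(p)} ∙ f^{⟨n⟩}_{p₁,…,pₙ})(q)| ≤ |ℳ_p(q)|, and for q ∈ 𝔹 with q ≠ p the inequality is strict unless f is a regular Blaschke product of degree n+1. -/

import Mathlib

noncomputable section

abbrev H : Type := Quaternion ℝ

namespace QPaper

/-- The complex slice determined by `I`: the real span of `1` and `I`. -/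
def sliceSet (I : H) : Set H := {q | ∃ x y : ℝ, q = (x : H) + y • I}

/-- Evaluation of the power series `q ↦ ∑ qᵐ aₘ` with right coefficients. -/
def evalC (a : ℕ → H) (q : H) : H := ∑' m, q ^ m * a m

/-- The series with coefficients `a` converges at every point of the unit ball. -/
def SummableOn (a : ℕ → H) : Prop := ∀ q : H, ‖q‖ < 1 → Summable fun m => q ^ m * a m

/-- `a` are the coefficients of a slice regular self-map of the unit ball. -/
def SelfMap (a : ℕ → H) : Prop :=
  SummableOn a ∧ ∀ q : H, ‖q‖ < 1 → ‖evalC a q‖ < 1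

/-- Coefficients of the ∗-product. -/
def starMulC (a b : ℕ → H) : ℕ → H := fun m => ∑ ℓ ∈ Finset.range (m + 1), a (m - ℓ) * b ℓ

/-- Coefficients of the ∗-inverse (of a series with invertible constant term). -/
def starInvC (a : ℕ → H) : ℕ → H
  | 0 => (a 0)⁻¹
  | m + 1 => -(a 0)⁻¹ * ∑ ℓ : Fin (m + 1), a (m + 1 - ℓ.val) * starInvC a ℓ.val
  decreasing_by exact ℓ.isLt

/-- Coefficients of `1 - q p̄`. -/
def oneMinusQPbarC (p : H) : ℕ → H := fun m => if m = 0 then 1 else if m = 1 then -(star p) else 0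

/-- Coefficients of `q - p`. -/
def qMinusPC (p : H) : ℕ → H := fun m => if m = 0 then -p else if m = 1 then 1 else 0

/-- Coefficients of the regular Möbius transformation `ℳ_p = (1 - q p̄)^{-∗} ∗ (q - p)`. -/
def mobiusC (p : H) : ℕ → H := starMulC (starInvC (oneMinusQPbarC p)) (qMinusPC p)

/-- Coefficients of `ℳ_{t₁} ∗ ⋯ ∗ ℳ_{t_κ}`. -/
def blaschkeListC : List H → (ℕ → H)
  | [] => fun m => if m = 0 then 1 else 0
  | t :: ts => starMulC (mobiusC t) (blaschkeListC ts)

/-- `a` are the coefficients of a regular Blaschke product of degree `κ`,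
i.e. of `ℳ_{t₁} ∗ ⋯ ∗ ℳ_{t_κ} u` with the `tᵢ` in `𝔹` and `u` unimodular. -/
def IsBlaschke (a : ℕ → H) (κ : ℕ) : Prop :=
  ∃ (ts : List H) (u : H), ts.length = κ ∧ (∀ t ∈ ts, ‖t‖ < 1) ∧ ‖u‖ = 1 ∧
    a = fun m => blaschkeListC ts m * u

/-- Coefficients of `ℳ_w ∙ f = (1 - f w̄)^{-∗} ∗ (f - w)`. -/
def bulletC (w : H) (a : ℕ → H) : ℕ → H :=
  starMulC (starInvC (fun m => (if m = 0 then (1 : H) else 0) - a m * star w))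
    (fun m => a m - if m = 0 then w else 0)

/-- Coefficients of the regular difference quotient `ℛ_{f,p}`,
the unique slice regular function with `f(q) = f(p) + (q - p) ∗ ℛ_{f,p}(q)`. -/
def diffQuotC (a : ℕ → H) (p : H) : ℕ → H := fun m => ∑' k, p ^ k * a (k + m + 1)

/-- Coefficients of the hyperbolic difference quotient
`f⋆_p = (1 - q p̄) ∗ ℛ_{f,p} ∗ (1 - \overline{f(p)} f)^{-∗} = ℳ_p^{-∗} ∗ (ℳ_{f(p)} ∙ f)`. -/
def hdqC (a : ℕ → H) (p : H) : ℕ → H :=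
  starMulC (starMulC (oneMinusQPbarC p) (diffQuotC a p))
    (starInvC (fun m => (if m = 0 then (1 : H) else 0) - star (evalC a p) * a m))

/-- Iterated hyperbolic difference quotients: `ihdqC a [p₁, …, pₙ] = ((f⋆_{p₁})⋆_{p₂} ⋯)⋆_{pₙ}`. -/
def ihdqC (a : ℕ → H) : List H → (ℕ → H)
  | [] => a
  | p :: ps => ihdqC (hdqC a p) ps

/-- `𝒯_p(q) = (1 - q p)⁻¹ q (1 - q p)`. -/
def mobiusT (p q : H) : H := (1 - q * p)⁻¹ * q * (1 - q * p)

/-- `M_p(q) = (1 - q p̄)⁻¹ (q - p)`. -/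
def mobiusM (p q : H) : H := (1 - q * star p)⁻¹ * (q - p)

/-- Pointwise evaluation of the regular Möbius transformation: `ℳ_p(q) = M_p(𝒯_p(q))`. -/
def mobiusEval (p q : H) : H := mobiusM p (mobiusT p q)

/-- The pseudo-hyperbolic distance `ρ(p,q) = |M_p(q)|`. -/
def rho (p q : H) : ℝ := ‖mobiusM p q‖

/-- The Poincaré distance `δ(p,q) = tanh⁻¹ ρ(p,q) = ½ log((1+ρ)/(1−ρ))`. -/
def pdist (p q : H) : ℝ := (1/2 : ℝ) * Real.log ((1 + rho p q) / (1 - rho p q))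


/-- formal power series with given coefficients -/
def ps (a : ℕ → H) : PowerSeries H := PowerSeries.mk a

lemma ps_coeff (a : ℕ → H) (m : ℕ) : PowerSeries.coeff m (ps a) = a m := by simp [ps]

lemma ps_inj {a b : ℕ → H} (h : ps a = ps b) : a = b := by
  funext m
  have := congrArg (PowerSeries.coeff m) h
  simpa [ps_coeff] using this

lemma ps_starMul (a b : ℕ → H) : ps (starMulC a b) = ps a * ps b := by
  ext1 m
  rw [ps_coeff, PowerSeries.coeff_mul]
  simp only [ps_coeff, starMulC]
  rw [← Finset.Nat.sum_antidiagonal_swap, Finset.Nat.sum_antidiagonal_eq_sum_range_succ_mk]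
  simp

lemma ps_add (a b : ℕ → H) : ps (a + b) = ps a + ps b := by
  ext1 m; simp [ps_coeff]

lemma ps_sub (a b : ℕ → H) : ps (fun m => a m - b m) = ps a - ps b := by
  ext1 m; simp [ps_coeff]

lemma ps_const (w : H) : ps (fun m => if m = 0 then w else 0) = PowerSeries.C w := by
  ext1 m
  rw [ps_coeff, PowerSeries.coeff_C]

lemma ps_cmul (w : H) (a : ℕ → H) : ps (fun m => w * a m) = PowerSeries.C w * ps a := by
  ext1 m; simp [ps_coeff]

lemma ps_mulc (w : H) (a : ℕ → H) : ps (fun m => a m * w) = ps a * PowerSeries.C w := by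
  ext1 m; simp [ps_coeff]

lemma ps_oneMinus (p : H) :
    ps (oneMinusQPbarC p) = 1 - PowerSeries.C (star p) * PowerSeries.X := by
  ext1 m
  rw [ps_coeff]
  rcases m with _ | _ | m
  · simp [oneMinusQPbarC]
  · rw [map_sub, PowerSeries.coeff_one, PowerSeries.coeff_succ_mul_X]
    simp [oneMinusQPbarC]
  · rw [map_sub, PowerSeries.coeff_one, PowerSeries.coeff_succ_mul_X, PowerSeries.coeff_C]
    simp [oneMinusQPbarC]

lemma ps_qMinus (p : H) : ps (qMinusPC p) = PowerSeries.X - PowerSeries.C p := by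
  ext1 m
  rw [ps_coeff]
  rcases m with _ | _ | m
  · simp [qMinusPC]
  · simp [qMinusPC, PowerSeries.coeff_C]
  · simp [qMinusPC, PowerSeries.coeff_C, PowerSeries.coeff_X]

lemma ps_mul_starInv (a : ℕ → H) (h : a 0 ≠ 0) : ps a * ps (starInvC a) = 1 := by
  rw [← ps_starMul]
  ext1 m
  rw [ps_coeff, PowerSeries.coeff_one]
  rcases m with _ | m
  · simp [starMulC, starInvC, h]
  · rw [starMulC, Finset.sum_range_succ, Finset.sum_range]
    simp only [Nat.sub_self]
    rw [starInvC]
    simp [← mul_assoc, h]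

lemma ps_ne_zero (a : ℕ → H) (h : a 0 ≠ 0) : ps a ≠ 0 := by
  intro h0
  apply h
  have := congrArg (PowerSeries.coeff 0) h0
  simpa [ps_coeff] using this

lemma ps_starInv_mul (a : ℕ → H) (h : a 0 ≠ 0) : ps (starInvC a) * ps a = 1 := by
  apply mul_left_cancel₀ (ps_ne_zero a h)
  rw [← mul_assoc, ps_mul_starInv a h, one_mul, mul_one]

lemma X_comm (A : PowerSeries H) : A * PowerSeries.X = PowerSeries.X * A :=
  (PowerSeries.commute_X A)

lemma C_star_mul (w : H) : PowerSeries.C (star w) * PowerSeries.C w =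
    (PowerSeries.C ((‖w‖ ^ 2 : ℝ) : H)) := by
  rw [← map_mul, Quaternion.star_mul_self, Quaternion.normSq_eq_norm_mul_self, sq]

lemma C_mul_star (w : H) : PowerSeries.C w * PowerSeries.C (star w) =
    (PowerSeries.C ((‖w‖ ^ 2 : ℝ) : H)) := by
  rw [← map_mul, Quaternion.self_mul_star, Quaternion.normSq_eq_norm_mul_self, sq]

lemma C_real_comm (r : ℝ) (A : PowerSeries H) :
    PowerSeries.C (r : H) * A = A * PowerSeries.C (r : H) := by
  ext1 m
  rw [PowerSeries.coeff_C_mul, PowerSeries.coeff_mul_C]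
  exact Quaternion.coe_commutes r _

lemma ring_aux1 {R : Type*} [Ring R] (x p s : R) (h1 : p * x = x * p) (h2 : s * x = x * s)
    (h3 : s * p = p * s) : (1 - s * x) * (x - p) = (x - p) * (1 - s * x) := by
  have e1 : (1 - s * x) * (x - p) = x - p - s * x * x + s * (x * p) := by noncomm_ring
  have e2 : (x - p) * (1 - s * x) = x - p - x * s * x + p * s * x := by noncomm_ring
  rw [e1, e2, ← h1, ← mul_assoc, h3, h2]

lemma ring_aux2 {R : Type*} [Ring R] (a w s : R) (h : w * s * a = a * (s * w)) :
    (a - w) * (1 - s * a) = (1 - a * s) * (a - w) := by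
  have e1 : (a - w) * (1 - s * a) = a - w - a * s * a + w * s * a := by noncomm_ring
  have e2 : (1 - a * s) * (a - w) = a - w - a * s * a + a * (s * w) := by noncomm_ring
  rw [e1, e2, h]

lemma mob_comm (p : H) : ps (oneMinusQPbarC p) * ps (qMinusPC p)
    = ps (qMinusPC p) * ps (oneMinusQPbarC p) := by
  rw [ps_oneMinus, ps_qMinus]
  exact ring_aux1 _ _ _ (X_comm _) (X_comm _) ((C_star_mul p).trans (C_mul_star p).symm)

lemma oneMinus_zero (p : H) : oneMinusQPbarC p 0 ≠ 0 := by simp [oneMinusQPbarC]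

/-- `(1 - q p̄) ∗ ℳ_p = q - p` -/
lemma oneMinus_mul_mob (p : H) : ps (oneMinusQPbarC p) * ps (mobiusC p) = ps (qMinusPC p) := by
  rw [mobiusC, ps_starMul, ← mul_assoc, ps_mul_starInv _ (oneMinus_zero p), one_mul]

lemma mob_mul_oneMinus (p : H) : ps (mobiusC p) * ps (oneMinusQPbarC p) = ps (qMinusPC p) := by
  rw [mobiusC, ps_starMul, mul_assoc, ← mob_comm, ← mul_assoc,
    ps_starInv_mul _ (oneMinus_zero p), one_mul]

lemma mob_ne_zero (p : H) : ps (mobiusC p) ≠ 0 := by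
  intro h
  have h1 := oneMinus_mul_mob p
  rw [h, mul_zero] at h1
  have := congrArg (PowerSeries.coeff 1) h1
  simp [ps_coeff, qMinusPC] at this

/-- the denominator sequence `1 - w̄ f`. -/
def denC (w : H) (a : ℕ → H) : ℕ → H := fun m => (if m = 0 then (1 : H) else 0) - star w * a m

lemma ps_denC (w : H) (a : ℕ → H) : ps (denC w a) = 1 - PowerSeries.C (star w) * ps a := by
  unfold denC
  rw [ps_sub, ps_const, ps_cmul, map_one]

lemma bullet_eq (w : H) (a : ℕ → H) (h1 : (1 : H) - a 0 * star w ≠ 0)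
    (h2 : (1 : H) - star w * a 0 ≠ 0) :
    ps (bulletC w a) * ps (denC w a) = ps a - PowerSeries.C w := by
  have hn : ps (fun m => (if m = 0 then (1 : H) else 0) - a m * star w)
      = 1 - ps a * PowerSeries.C (star w) := by
    rw [ps_sub, ps_const, ps_mulc, map_one]
  have hb : ps (bulletC w a) = ps (starInvC (fun m => (if m = 0 then (1 : H) else 0) - a m * star w))
      * (ps a - PowerSeries.C w) := by
    rw [bulletC, ps_starMul, ps_sub, ps_const]
  apply mul_left_cancel₀ (ps_ne_zero (fun m => (if m = 0 then (1 : H) else 0) - a m * star w)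
    (by simpa using h1))
  rw [hb, ← mul_assoc, ← mul_assoc, ps_mul_starInv _ (by simpa using h1), one_mul, hn, ps_denC]
  exact ring_aux2 _ _ _ (by rw [C_mul_star, C_star_mul]; exact C_real_comm _ _)

lemma hdq_eq (a : ℕ → H) (p : H) (h2 : (1 : H) - star (evalC a p) * a 0 ≠ 0)
    (hR : ps (qMinusPC p) * ps (diffQuotC a p) = ps a - PowerSeries.C (evalC a p)) :
    ps (mobiusC p) * ps (hdqC a p) * ps (denC (evalC a p) a) = ps a - PowerSeries.C (evalC a p) := by
  have : ps (hdqC a p) = ps (oneMinusQPbarC p) * ps (diffQuotC a p)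
      * ps (starInvC (denC (evalC a p) a)) := by
    rw [hdqC, ps_starMul, ps_starMul]; rfl
  rw [this, mul_assoc, mul_assoc, ps_starInv_mul _ (by simpa [denC] using h2), mul_one, ← mul_assoc,
    mob_mul_oneMinus, hR]

lemma hdq_bullet (a : ℕ → H) (p : H) (h1 : (1 : H) - a 0 * star (evalC a p) ≠ 0)
    (h2 : (1 : H) - star (evalC a p) * a 0 ≠ 0)
    (hR : ps (qMinusPC p) * ps (diffQuotC a p) = ps a - PowerSeries.C (evalC a p)) :
    ps (bulletC (evalC a p) a) = ps (mobiusC p) * ps (hdqC a p) := by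
  apply mul_right_cancel₀ (ps_ne_zero (denC (evalC a p) a) (by simpa [denC] using h2))
  rw [bullet_eq _ _ h1 h2, hdq_eq _ _ h2 hR]

lemma diffQuot_eq (a : ℕ → H) (p : H)
    (hs' : ∀ m, Summable fun k => p ^ k * a (k + m)) :
    ps (qMinusPC p) * ps (diffQuotC a p) = ps a - PowerSeries.C (evalC a p) := by
  rw [ps_qMinus]
  have key : ∀ m, ∑' k, p ^ k * a (k + m) = a m + p * diffQuotC a p m := by
    intro m
    rw [(hs' m).tsum_eq_zero_add, diffQuotC, ← tsum_mul_left]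
    simp only [pow_zero, one_mul, zero_add]
    congr 1
    apply tsum_congr
    intro k
    rw [pow_succ', mul_assoc, add_right_comm]
  ext1 m
  rw [sub_mul, map_sub, map_sub, PowerSeries.coeff_C_mul, ps_coeff, ps_coeff]
  rcases m with _ | m
  · have := key 0
    simp only [add_zero] at this
    simp [evalC, this]
  · rw [PowerSeries.coeff_succ_X_mul, ps_coeff, PowerSeries.coeff_C]
    have := key (m+1)
    simp only [Nat.succ_ne_zero, if_false, sub_zero]
    rw [sub_eq_iff_eq_add, ← this, diffQuotC]
    apply tsum_congr
    intro k
    rw [add_assoc]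


lemma re_mul_comm (u v : H) : (u * v).re = (v * u).re := by
  simp only [Quaternion.re_mul]; ring

lemma norm_sq_re (u : H) : ‖u‖ ^ 2 = (u * star u).re := by
  rw [Quaternion.self_mul_star, Quaternion.normSq_eq_norm_mul_self, Quaternion.re_coe, sq]

lemma root_sum (N : ℕ) (hN : 0 < N) (ζ : ℂ) (hζ : IsPrimitiveRoot ζ N) (m n : ℕ) (hm : m < N)
    (hn : n < N) : ∑ k ∈ Finset.range N, (starRingEnd ℂ) ((ζ ^ k) ^ n) * (ζ ^ k) ^ m
      = if m = n then (N : ℂ) else 0 := by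
  have hnorm : ‖ζ‖ = 1 := hζ.norm'_eq_one hN.ne'
  have hconj : (starRingEnd ℂ) ζ * ζ = 1 := by
    rw [Complex.conj_mul', hnorm]; simp
  have h0 : ∀ k, (starRingEnd ℂ) ((ζ ^ k) ^ n) * (ζ ^ k) ^ m = ((starRingEnd ℂ) ζ ^ n * ζ ^ m) ^ k := by
    intro k
    simp only [map_pow]
    rw [mul_pow, ← pow_mul, ← pow_mul, ← pow_mul, ← pow_mul, mul_comm k n, mul_comm k m]
  simp_rw [h0]
  split_ifs with h
  · subst h
    rw [← mul_pow, hconj]; simp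
  · have hne : (starRingEnd ℂ) ζ ^ n * ζ ^ m ≠ 1 := by
      intro h1
      apply h
      apply hζ.pow_inj hm hn
      have : ζ ^ n * ((starRingEnd ℂ) ζ ^ n * ζ ^ m) = ζ ^ n := by rw [h1, mul_one]
      rwa [← mul_assoc, ← mul_pow, mul_comm ζ, hconj, one_pow, one_mul] at this
    rw [geom_sum_eq hne]
    have : ((starRingEnd ℂ) ζ ^ n * ζ ^ m) ^ N = 1 := by
      rw [mul_pow, ← pow_mul, ← pow_mul, mul_comm n, mul_comm m, pow_mul, pow_mul, ← map_pow,
        hζ.pow_eq_one]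
      simp
    rw [this]; simp

lemma parseval (N : ℕ) (hN : 0 < N) : ∃ ω : H, ‖ω‖ = 1 ∧ ∀ x : ℕ → H,
    ∑ k ∈ Finset.range N, ‖∑ m ∈ Finset.range N, (ω ^ k) ^ m * x m‖ ^ 2
      = N * ∑ m ∈ Finset.range N, ‖x m‖ ^ 2 := by
  have hζ := Complex.isPrimitiveRoot_exp N hN.ne'
  set ζ := Complex.exp (2 * Real.pi * Complex.I / N) with hζd
  have hnorm : ‖ζ‖ = 1 := hζ.norm'_eq_one hN.ne'
  refine ⟨Quaternion.ofComplex ζ, ?_, ?_⟩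
  · have h : ‖(ζ : H)‖ = ‖ζ‖ := by
      rw [← sq_eq_sq₀ (norm_nonneg _) (norm_nonneg _), norm_sq_re, Complex.sq_norm,
        Complex.normSq_apply, Quaternion.re_mul]
      simp
    simpa [hnorm] using h
  · intro x
    have hstar : ∀ z : ℂ, star (Quaternion.ofComplex z) = Quaternion.ofComplex ((starRingEnd ℂ) z) := by
      intro z
      ext <;> simp
    have h1 : ∀ k, ‖∑ m ∈ Finset.range N, (Quaternion.ofComplex ζ ^ k) ^ m * x m‖ ^ 2
        = ∑ m ∈ Finset.range N, ∑ n ∈ Finset.range N,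
          (Quaternion.ofComplex ((starRingEnd ℂ) ((ζ ^ k) ^ n) * (ζ ^ k) ^ m) * (x m * star (x n))).re := by
      intro k
      rw [norm_sq_re, star_sum, Finset.sum_mul_sum]
      have hre : ∀ (s : Finset ℕ) (f : ℕ → H), (∑ i ∈ s, f i).re = ∑ i ∈ s, (f i).re := by
        intro s f
        exact map_sum (QuaternionAlgebra.reₗ _ _ _ : H →ₗ[ℝ] ℝ) f s
      rw [hre]
      apply Finset.sum_congr rfl
      intro m _
      rw [hre]
      apply Finset.sum_congr rfl
      intro n _
      rw [star_mul, ← map_pow, ← map_pow, ← map_pow, hstar, ← mul_assoc, re_mul_comm, map_mul]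
      simp only [mul_assoc]
    simp_rw [h1]
    rw [Finset.sum_comm]
    rw [Finset.mul_sum]
    apply Finset.sum_congr rfl
    intro m hm
    rw [Finset.sum_comm]
    have h2 : ∀ n ∈ Finset.range N, ∑ k ∈ Finset.range N,
        (Quaternion.ofComplex ((starRingEnd ℂ) ((ζ ^ k) ^ n) * (ζ ^ k) ^ m) * (x m * star (x n))).re
        = if m = n then (N : ℝ) * ‖x m‖ ^ 2 else 0 := by
      intro n hn
      have hre : ∀ (s : Finset ℕ) (f : ℕ → H), (∑ i ∈ s, f i).re = ∑ i ∈ s, (f i).re := by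
        intro s f
        exact map_sum (QuaternionAlgebra.reₗ _ _ _ : H →ₗ[ℝ] ℝ) f s
      rw [← hre, ← Finset.sum_mul, ← map_sum, root_sum N hN ζ hζ m n (Finset.mem_range.1 hm)
        (Finset.mem_range.1 hn)]
      split_ifs with h
      · subst h
        rw [norm_sq_re, map_natCast]
        rw [← nsmul_eq_mul, ← nsmul_eq_mul]
        exact map_nsmul (QuaternionAlgebra.reₗ _ _ _ : H →ₗ[ℝ] ℝ) _ _
      · rw [map_zero, zero_mul]; rfl
    rw [Finset.sum_congr rfl h2]
    simp [Finset.mem_range.1 hm]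

lemma conj_pow_mul (q β x : H) (hβ : β ≠ 0) (l : ℕ) :
    q ^ l * (β * x) = β * ((β⁻¹ * q * β) ^ l * x) := by
  have : β * (β⁻¹ * q * β) ^ l = q ^ l * β := by
    induction l with
    | zero => simp
    | succ l ih =>
      rw [pow_succ, ← mul_assoc, ih, pow_succ]
      simp only [mul_assoc]
      rw [mul_inv_cancel_left₀ hβ]
  rw [← mul_assoc, ← mul_assoc, this]

lemma norm_conj (q β : H) (hβ : β ≠ 0) : ‖β⁻¹ * q * β‖ = ‖q‖ := by
  rw [norm_mul, norm_mul, norm_inv]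
  have : ‖β‖ ≠ 0 := norm_ne_zero_iff.2 hβ
  field_simp

lemma rc_aux (a : ℕ → H) (ha : SelfMap a) (N M : ℕ) (hNM : N ≤ M) (hN : 0 < N) (b : ℕ → H) (r : ℝ)
    (hr0 : 0 < r) (hr1 : r < 1) :
    ∑ m ∈ Finset.range N, ‖starMulC b (fun j => ((r ^ j : ℝ) : H) * a j) m‖ ^ 2 ≤
      (1 + ∑' j, ‖((r ^ (j + M) : ℝ) : H) * a (j + M)‖) ^ 2 * ∑ m ∈ Finset.range N, ‖b m‖ ^ 2 := by
  set ε := ∑' j, ‖((r ^ (j + M) : ℝ) : H) * a (j + M)‖ with hε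
  have hε0 : 0 ≤ ε := tsum_nonneg fun _ => norm_nonneg _
  have hsum : Summable fun j => ‖((r ^ j : ℝ) : H) * a j‖ := by
    have := ha.1 (r : H) (by rw [Quaternion.norm_coe, Real.norm_eq_abs, abs_of_pos hr0]; exact hr1)
    rw [← summable_norm_iff] at this
    simpa using this
  set c : ℕ → H := fun j => if j < M then ((r ^ j : ℝ) : H) * a j else 0 with hc
  set b' : ℕ → H := fun l => if l < N then b l else 0 with hb'
  obtain ⟨ω, hω, hP⟩ := parseval (N + M) (by omega)
  have hG : ∀ q : H, ∑ m ∈ Finset.range (N + M), q ^ m * starMulC b' c m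
      = ∑ l ∈ Finset.range M, q ^ l * ((∑ j ∈ Finset.range N, q ^ j * b j) * (((r ^ l : ℝ) : H) * a l)) := by
    intro q
    have h1 : ∑ m ∈ Finset.range (N + M), q ^ m * starMulC b' c m
      = ∑ m ∈ Finset.range (N + M), ∑ l ∈ Finset.range (m + 1),
        (fun l j => q ^ (l + j) * (b' j * c l)) l (m - l) := by
      apply Finset.sum_congr rfl
      intro m _
      rw [starMulC, Finset.mul_sum]
      apply Finset.sum_congr rfl
      intro l hl
      have : l + (m - l) = m := by have := Finset.mem_range.1 hl; omega
      simp only [this]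
    rw [h1, Finset.sum_range_diag_flip (N + M) (fun l j => q ^ (l + j) * (b' j * c l)), add_comm N M, Finset.sum_range_add]
    rw [Finset.sum_eq_zero (s := Finset.range N), add_zero]
    · apply Finset.sum_congr rfl
      intro l hl
      have hl' := Finset.mem_range.1 hl
      rw [← Finset.sum_subset (s₁ := Finset.range N)]
      · rw [Finset.sum_mul, Finset.mul_sum]
        apply Finset.sum_congr rfl
        intro j hj
        simp only [hb', hc, hl', Finset.mem_range.1 hj, if_true, pow_add, mul_assoc]
      · intro j hj
        have := Finset.mem_range.1 hj
        rw [Finset.mem_range]; omega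
      · intro j _ hj
        have : ¬ j < N := by simpa using hj
        simp [hb', this]
    · intro l _
      apply Finset.sum_eq_zero
      intro j _
      simp [hc]
  have hbd : ∀ q : H, ‖q‖ = 1 → ‖∑ m ∈ Finset.range (N + M), q ^ m * starMulC b' c m‖ ≤
      (1 + ε) * ‖∑ m ∈ Finset.range (N + M), q ^ m * b' m‖ := by
    intro q hq
    have hβ : ∑ m ∈ Finset.range (N + M), q ^ m * b' m = ∑ j ∈ Finset.range N, q ^ j * b j := by
      rw [← Finset.sum_subset (s₁ := Finset.range N)]
      · apply Finset.sum_congr rfl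
        intro j hj
        simp only [hb', Finset.mem_range.1 hj, if_true]
      · intro j hj
        have := Finset.mem_range.1 hj
        rw [Finset.mem_range]; omega
      · intro j _ hj
        have : ¬ j < N := by simpa using hj
        simp [hb', this]
    rw [hG, hβ]
    set β := ∑ j ∈ Finset.range N, q ^ j * b j
    by_cases h0 : β = 0
    · simp [h0]
    · simp_rw [conj_pow_mul q β _ h0]
      rw [← Finset.mul_sum, norm_mul, mul_comm]
      apply mul_le_mul_of_nonneg_right _ (norm_nonneg _)
      set q' := β⁻¹ * q * β
      have hq' : ‖q'‖ = 1 := by rw [norm_conj q β h0, hq]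
      have hrq : ‖(r : H) * q'‖ < 1 := by
        rw [norm_mul, hq', mul_one, Quaternion.norm_coe, Real.norm_eq_abs, abs_of_pos hr0]; exact hr1
      have hterm : ∀ l, q' ^ l * (((r ^ l : ℝ) : H) * a l) = ((r : H) * q') ^ l * a l := by
        intro l
        rw [(show Commute (r : H) q' from Quaternion.coe_commutes r q').mul_pow, ← mul_assoc,
          Quaternion.coe_pow, ← Quaternion.coe_pow, Quaternion.coe_commutes]
      simp_rw [hterm]
      have hs := ha.1 _ hrq
      have he := ha.2 _ hrq
      rw [evalC, ← hs.sum_add_tsum_nat_add M] at he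
      set A := ∑ i ∈ Finset.range M, ((r : H) * q') ^ i * a i
      set B := ∑' i, ((r : H) * q') ^ (i + M) * a (i + M)
      have hB : ‖B‖ ≤ ε := by
        have hn : ∀ i, ‖((r : H) * q') ^ (i + M) * a (i + M)‖ = ‖((r ^ (i + M) : ℝ) : H) * a (i + M)‖ := by
          intro i
          rw [← hterm, norm_mul, norm_pow, hq', one_pow, one_mul]
        refine (norm_tsum_le_tsum_norm ?_).trans (le_of_eq ?_)
        · simp_rw [hn]
          exact (summable_nat_add_iff M).2 hsum
        · simp_rw [hn]; rfl
      have : A = (A + B) - B := by abel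
      rw [this]
      exact (norm_sub_le _ _).trans (add_le_add he.le hB)
  have hK : (0 : ℝ) < ((N + M : ℕ) : ℝ) := by exact_mod_cast (by omega : 0 < N + M)
  have h1 := hP (starMulC b' c)
  have h2 := hP b'
  have h3 : ((N + M : ℕ) : ℝ) * ∑ m ∈ Finset.range (N + M), ‖starMulC b' c m‖ ^ 2 ≤
      ((N + M : ℕ) : ℝ) * ((1 + ε) ^ 2 * ∑ m ∈ Finset.range (N + M), ‖b' m‖ ^ 2) := by
    rw [← h1, mul_left_comm, ← h2, Finset.mul_sum]
    apply Finset.sum_le_sum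
    intro k _
    rw [← mul_pow]
    exact pow_le_pow_left₀ (norm_nonneg _) (hbd _ (by rw [norm_pow, hω, one_pow])) 2
  have h4 := le_of_mul_le_mul_left h3 hK
  calc ∑ m ∈ Finset.range N, ‖starMulC b (fun j => ((r ^ j : ℝ) : H) * a j) m‖ ^ 2
      = ∑ m ∈ Finset.range N, ‖starMulC b' c m‖ ^ 2 := by
        apply Finset.sum_congr rfl
        intro m hm
        have hm' := Finset.mem_range.1 hm
        congr 2
        apply Finset.sum_congr rfl
        intro l hl
        have hl' := Finset.mem_range.1 hl
        simp only [hb', hc]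
        rw [if_pos (by omega), if_pos (by omega)]
    _ ≤ ∑ m ∈ Finset.range (N + M), ‖starMulC b' c m‖ ^ 2 := by
        apply Finset.sum_le_sum_of_subset_of_nonneg
        · intro j hj
          have := Finset.mem_range.1 hj
          rw [Finset.mem_range]; omega
        · intros; positivity
    _ ≤ _ := h4
    _ = _ := by
        congr 1
        rw [← Finset.sum_subset (s₁ := Finset.range N)]
        · apply Finset.sum_congr rfl
          intro j hj
          simp only [hb', Finset.mem_range.1 hj, if_true]
        · intro j hj
          have := Finset.mem_range.1 hj
          rw [Finset.mem_range]; omega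
        · intro j _ hj
          have : ¬ j < N := by simpa using hj
          simp [hb', this]

lemma rc (a : ℕ → H) (ha : SelfMap a) (N : ℕ) (b : ℕ → H) :
    ∑ m ∈ Finset.range N, ‖starMulC b a m‖ ^ 2 ≤ ∑ m ∈ Finset.range N, ‖b m‖ ^ 2 := by
  rcases Nat.eq_zero_or_pos N with hN | hN
  · simp [hN]
  have h1 : ∀ r : ℝ, 0 < r → r < 1 →
      ∑ m ∈ Finset.range N, ‖starMulC b (fun j => ((r ^ j : ℝ) : H) * a j) m‖ ^ 2 ≤
        ∑ m ∈ Finset.range N, ‖b m‖ ^ 2 := by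
    intro r hr0 hr1
    have ht : Filter.Tendsto (fun M => (1 + ∑' j, ‖((r ^ (j + M) : ℝ) : H) * a (j + M)‖) ^ 2 *
        ∑ m ∈ Finset.range N, ‖b m‖ ^ 2) Filter.atTop (nhds ((1 + 0) ^ 2 * ∑ m ∈ Finset.range N, ‖b m‖ ^ 2)) := by
      apply Filter.Tendsto.mul_const
      apply Filter.Tendsto.pow
      apply Filter.Tendsto.const_add
      exact tendsto_sum_nat_add (fun j => ‖((r ^ j : ℝ) : H) * a j‖)
    have := ge_of_tendsto ht (Filter.eventually_atTop.2 ⟨N, fun M hM =>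
      rc_aux a ha N M hM hN b r hr0 hr1⟩)
    simpa using this
  have hcont : Continuous fun r : ℝ =>
      ∑ m ∈ Finset.range N, ‖starMulC b (fun j => ((r ^ j : ℝ) : H) * a j) m‖ ^ 2 := by
    unfold starMulC
    have : Continuous fun r : ℝ => (r : H) := Quaternion.continuous_coe
    fun_prop
  have ht : Filter.Tendsto (fun r : ℝ =>
      ∑ m ∈ Finset.range N, ‖starMulC b (fun j => ((r ^ j : ℝ) : H) * a j) m‖ ^ 2) (nhdsWithin 1 (Set.Iio 1))
      (nhds (∑ m ∈ Finset.range N, ‖starMulC b a m‖ ^ 2)) := by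
    have := (hcont.tendsto 1).mono_left (nhdsWithin_le_nhds (s := Set.Iio 1))
    simpa using this
  refine le_of_tendsto ht ?_
  filter_upwards [Ioo_mem_nhdsLT (show (0 : ℝ) < 1 by norm_num)] with r hr
  exact h1 r hr.1 hr.2

lemma lc (a : ℕ → H) (ha : SelfMap a) (N : ℕ) (y : ℕ → H) :
    ∑ m ∈ Finset.range N, ‖starMulC a y m‖ ^ 2 ≤ ∑ m ∈ Finset.range N, ‖y m‖ ^ 2 := by
  rcases N with _ | N
  · simp
  set c := starMulC a y with hc
  set x : ℕ → H := fun m => star (c (N - m)) with hx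
  set Y := ∑ m ∈ Finset.range (N + 1), ‖c m‖ ^ 2 with hY
  have hassoc : starMulC (starMulC x a) y = starMulC x c := by
    apply ps_inj
    rw [hc]
    simp only [ps_starMul, mul_assoc]
  have hxn : ∑ m ∈ Finset.range (N + 1), ‖x m‖ ^ 2 = Y := by
    rw [hY, ← Finset.sum_range_reflect]
    apply Finset.sum_congr rfl
    intro m hm
    have : N - (N - m) = m := by have := Finset.mem_range.1 hm; omega
    simp [hx, this]
  have h1 : starMulC x c N = ((Y : ℝ) : H) := by
    rw [starMulC, hY]
    have : ∀ r : ℕ → ℝ, ((∑ m ∈ Finset.range (N + 1), r m : ℝ) : H) = ∑ m ∈ Finset.range (N + 1), (r m : H) := by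
      intro r
      simp only [← Quaternion.algebraMap_def, map_sum]
    rw [this]
    apply Finset.sum_congr rfl
    intro l hl
    have hl' := Finset.mem_range.1 hl
    have : N - (N - l) = l := by omega
    simp only [hx, this]
    rw [Quaternion.star_mul_self, Quaternion.normSq_eq_norm_mul_self, sq]
  have h2 : Y ≤ ∑ l ∈ Finset.range (N + 1), ‖starMulC x a (N - l)‖ * ‖y l‖ := by
    have h3 : ‖starMulC x c N‖ = Y := by
      rw [h1, Quaternion.norm_coe, Real.norm_eq_abs, abs_of_nonneg]
      rw [hY]; positivity
    rw [← h3, ← hassoc]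
    conv_lhs => rw [starMulC]
    refine (norm_sum_le _ _).trans (le_of_eq ?_)
    simp only [norm_mul]
  have h4 : Y ^ 2 ≤ Y * ∑ m ∈ Finset.range (N + 1), ‖y m‖ ^ 2 := by
    have hY0 : 0 ≤ Y := by rw [hY]; positivity
    calc Y ^ 2 ≤ (∑ l ∈ Finset.range (N + 1), ‖starMulC x a (N - l)‖ * ‖y l‖) ^ 2 :=
          pow_le_pow_left₀ hY0 h2 2
      _ ≤ (∑ l ∈ Finset.range (N + 1), ‖starMulC x a (N - l)‖ ^ 2) * ∑ l ∈ Finset.range (N + 1), ‖y l‖ ^ 2 :=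
          Finset.sum_mul_sq_le_sq_mul_sq _ _ _
      _ ≤ _ := by
          apply mul_le_mul_of_nonneg_right _ (by positivity)
          have := Finset.sum_range_reflect (fun m => ‖starMulC x a m‖ ^ 2) (N + 1)
          simp only [Nat.add_sub_cancel] at this
          rw [this, ← hxn]
          exact rc a ha (N + 1) x
  by_contra hcon
  push Not at hcon
  have hy0 : 0 ≤ ∑ m ∈ Finset.range (N + 1), ‖y m‖ ^ 2 := by positivity
  nlinarith


/-- the real Hilbert space of square summable quaternionic sequences -/
abbrev LH : Type := lp (fun _ : ℕ => H) 2

lemma LH_norm_sq (x : LH) : ‖x‖ ^ 2 = ∑' m, ‖x m‖ ^ 2 := by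
  have := lp.norm_rpow_eq_tsum (p := 2) (by norm_num) x
  simpa using this

lemma LH_summable (x : LH) : Summable fun m => ‖x m‖ ^ 2 := by
  have := (memℓp_gen_iff (p := 2) (by norm_num)).1 (lp.memℓp x)
  simpa using this

lemma LH_mem {f : ℕ → H} (h : Summable fun m => ‖f m‖ ^ 2) : Memℓp f 2 := by
  rw [memℓp_gen_iff (by norm_num)]
  simpa using h

lemma exists_op (φ : (ℕ → H) →ₗ[ℝ] (ℕ → H)) (C : ℝ) (hC : 0 ≤ C)
    (h : ∀ N x, ∑ m ∈ Finset.range N, ‖φ x m‖ ^ 2 ≤ C ^ 2 * ∑ m ∈ Finset.range N, ‖x m‖ ^ 2) :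
    ∃ F : LH →L[ℝ] LH, (∀ x : LH, (F x : ℕ → H) = φ x) ∧ ∀ x, ‖F x‖ ≤ C * ‖x‖ := by
  have hb : ∀ (x : LH) N, ∑ m ∈ Finset.range N, ‖φ x m‖ ^ 2 ≤ C ^ 2 * ‖x‖ ^ 2 := by
    intro x N
    refine (h N x).trans (mul_le_mul_of_nonneg_left ?_ (sq_nonneg _))
    rw [LH_norm_sq]
    exact (LH_summable x).sum_le_tsum _ (fun _ _ => sq_nonneg _)
  have hs : ∀ x : LH, Summable fun m => ‖φ x m‖ ^ 2 := fun x =>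
    summable_of_sum_range_le (fun _ => sq_nonneg _) (hb x)
  let L : LH →ₗ[ℝ] LH :=
    { toFun := fun x => ⟨φ x, LH_mem (hs x)⟩
      map_add' := by
        intro x y
        apply Subtype.ext
        change φ (↑(x + y)) = φ x + φ y
        rw [lp.coeFn_add, map_add]
      map_smul' := by
        intro r x
        apply Subtype.ext
        change φ (↑(r • x)) = r • φ x
        rw [lp.coeFn_smul, map_smul] }
  have hL : ∀ x, ‖L x‖ ≤ C * ‖x‖ := by
    intro x
    apply (sq_le_sq₀ (norm_nonneg _) (by positivity)).1
    rw [LH_norm_sq, mul_pow]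
    exact Real.tsum_le_of_sum_range_le (fun _ => sq_nonneg _) (hb x)
  exact ⟨L.mkContinuous C hL, fun x => rfl, hL⟩

/-- `F` is left multiplication by the formal power series `A`. -/
def IsM (A : PowerSeries H) (F : LH →L[ℝ] LH) : Prop := ∀ x : LH, ps (F x) = A * ps x

lemma LH_ext {x y : LH} (h : ps x = ps y) : x = y := Subtype.ext (ps_inj h)

lemma IsM_of_contr (a : ℕ → H) (C : ℝ) (hC : 0 ≤ C)
    (h : ∀ N x, ∑ m ∈ Finset.range N, ‖starMulC a x m‖ ^ 2 ≤ C ^ 2 * ∑ m ∈ Finset.range N, ‖x m‖ ^ 2) :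
    ∃ F, IsM (ps a) F ∧ ∀ x, ‖F x‖ ≤ C * ‖x‖ := by
  obtain ⟨F, h1, h2⟩ := exists_op
    { toFun := fun x => starMulC a x
      map_add' := by
        intro x y
        funext m
        simp only [starMulC, Pi.add_apply, mul_add, Finset.sum_add_distrib]
      map_smul' := by
        intro r x
        funext m
        simp only [starMulC, Pi.smul_apply, mul_smul_comm, Finset.smul_sum, RingHom.id_apply] } C hC h
  refine ⟨F, fun x => ?_, h2⟩
  rw [h1]
  exact ps_starMul a x

lemma IsM.mul {A B : PowerSeries H} {F G : LH →L[ℝ] LH} (hF : IsM A F) (hG : IsM B G) :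
    IsM (A * B) (F * G) := by
  intro x
  rw [ContinuousLinearMap.mul_apply, hF, hG, mul_assoc]

lemma LH_ps_sub (x y : LH) : ps (x - y : LH) = ps x - ps y := by
  rw [← ps_sub]; rfl

lemma IsM.sub {A B : PowerSeries H} {F G : LH →L[ℝ] LH} (hF : IsM A F) (hG : IsM B G) :
    IsM (A - B) (F - G) := by
  intro x
  rw [ContinuousLinearMap.sub_apply, LH_ps_sub, hF, hG, sub_mul]

lemma IsM.one : IsM 1 1 := by
  intro x; simp

lemma IsM.uniq {A : PowerSeries H} {F G : LH →L[ℝ] LH} (hF : IsM A F) (hG : IsM A G) : F = G := by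
  ext1 x
  exact LH_ext ((hF x).trans (hG x).symm)

lemma exists_Cop (w : H) : ∃ F : LH →L[ℝ] LH, ∀ x m, (F x : ℕ → H) m = w * x m := by
  obtain ⟨F, h1, -⟩ := exists_op
    { toFun := fun x m => w * x m
      map_add' := by intro x y; funext m; simp [mul_add]
      map_smul' := by intro r x; funext m; simp } ‖w‖ (norm_nonneg _) (by
        intro N x
        simp [mul_pow, Finset.mul_sum])
  exact ⟨F, fun x m => by rw [h1]; rfl⟩

/-- left multiplication by a constant -/
def Cop (w : H) : LH →L[ℝ] LH := Classical.choose (exists_Cop w)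

lemma Cop_apply (w : H) (x : LH) (m : ℕ) : (Cop w x : ℕ → H) m = w * x m :=
  Classical.choose_spec (exists_Cop w) x m

lemma exists_Rop (w : H) : ∃ F : LH →L[ℝ] LH, ∀ x m, (F x : ℕ → H) m = x m * w := by
  obtain ⟨F, h1, -⟩ := exists_op
    { toFun := fun x m => x m * w
      map_add' := by intro x y; funext m; simp [add_mul]
      map_smul' := by intro r x; funext m; simp } ‖w‖ (norm_nonneg _) (by
        intro N x
        simp [mul_pow, Finset.mul_sum, mul_comm])
  exact ⟨F, fun x m => by rw [h1]; rfl⟩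

/-- right multiplication by a constant -/
def Rop (w : H) : LH →L[ℝ] LH := Classical.choose (exists_Rop w)

lemma Rop_apply (w : H) (x : LH) (m : ℕ) : (Rop w x : ℕ → H) m = x m * w :=
  Classical.choose_spec (exists_Rop w) x m

lemma IsM.Cop (w : H) : IsM (PowerSeries.C w) (Cop w) := by
  intro x
  rw [← ps_cmul]
  congr 1
  funext m
  exact Cop_apply w x m

lemma exists_Sop : ∃ F : LH →L[ℝ] LH, ∀ x, (F x : ℕ → H) 0 = 0 ∧ ∀ m, (F x : ℕ → H) (m + 1) = x m := by
  obtain ⟨F, h1, -⟩ := exists_op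
    { toFun := fun x m => Nat.casesOn m 0 x
      map_add' := by intro x y; funext m; cases m <;> simp
      map_smul' := by intro r x; funext m; cases m <;> simp } 1 (by norm_num) (by
        intro N x
        rcases N with _ | N
        · simp
        · rw [Finset.sum_range_succ']
          simp [Finset.sum_range_succ]
          )
  refine ⟨F, fun x => ⟨by rw [h1]; rfl, fun m => by rw [h1]; rfl⟩⟩

/-- the shift -/
def Sop : LH →L[ℝ] LH := Classical.choose exists_Sop

lemma Sop_zero (x : LH) : (Sop x : ℕ → H) 0 = 0 := (Classical.choose_spec exists_Sop x).1
lemma Sop_succ (x : LH) (m : ℕ) : (Sop x : ℕ → H) (m + 1) = x m :=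
  (Classical.choose_spec exists_Sop x).2 m

lemma IsM.Sop : IsM PowerSeries.X Sop := by
  intro x
  ext1 m
  rcases m with _ | m
  · rw [ps_coeff, Sop_zero]; simp
  · rw [ps_coeff, Sop_succ, PowerSeries.coeff_succ_X_mul, ps_coeff]

lemma Cop_norm (w : H) (x : LH) : ‖Cop w x‖ = ‖w‖ * ‖x‖ := by
  rw [← sq_eq_sq₀ (norm_nonneg _) (by positivity), mul_pow, LH_norm_sq, LH_norm_sq]
  simp only [Cop_apply, norm_mul, mul_pow, tsum_mul_left]

lemma Sop_norm (x : LH) : ‖Sop x‖ = ‖x‖ := by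
  rw [← sq_eq_sq₀ (norm_nonneg _) (by positivity), LH_norm_sq, LH_norm_sq,
    (LH_summable (Sop x)).tsum_eq_zero_add]
  simp only [Sop_zero, Sop_succ]
  simp

open ContinuousLinearMap in
lemma Cop_adj (w : H) : adjoint (Cop w) = Cop (star w) := by
  symm
  rw [eq_adjoint_iff]
  intro x y
  rw [lp.inner_eq_tsum, lp.inner_eq_tsum]
  apply tsum_congr
  intro m
  rw [Cop_apply, Cop_apply, Quaternion.inner_def, Quaternion.inner_def, star_mul, mul_assoc,
    re_mul_comm, mul_assoc]

open ContinuousLinearMap in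
lemma Rop_adj (w : H) : adjoint (Rop w) = Rop (star w) := by
  symm
  rw [eq_adjoint_iff]
  intro x y
  rw [lp.inner_eq_tsum, lp.inner_eq_tsum]
  apply tsum_congr
  intro m
  rw [Rop_apply, Rop_apply, Quaternion.inner_def, Quaternion.inner_def, star_mul, mul_assoc]

lemma single_apply (i j : ℕ) (μ : H) : (lp.single 2 i μ : LH) j = if j = i then μ else 0 := by
  rw [lp.single_apply]
  split_ifs with h
  · subst h; simp
  · simp [h]

lemma inner_single (i : ℕ) (μ : H) (x : LH) :
    inner ℝ μ (x i) = inner ℝ (lp.single 2 i μ : LH) x := (lp.inner_single_left i μ x).symm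

open ContinuousLinearMap in
lemma Sop_adj (x : LH) (m : ℕ) : (adjoint Sop x : ℕ → H) m = x (m + 1) := by
  apply ext_inner_left ℝ
  intro μ
  refine (inner_single m μ _).trans ?_
  refine Eq.trans ?_ (inner_single (m + 1) μ _).symm
  rw [adjoint_inner_right]
  congr 1
  apply LH_ext
  ext1 j
  rw [ps_coeff, ps_coeff]
  rcases j with _ | j
  · rw [Sop_zero, single_apply]; simp
  · rw [Sop_succ, single_apply, single_apply]; simp

lemma IsM.comm_R {A : PowerSeries H} {F : LH →L[ℝ] LH} (hF : IsM A F) (w : H) :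
    F * Rop w = Rop w * F := by
  ext1 x
  have hR : ∀ y : LH, ps (Rop w y) = ps y * PowerSeries.C w := by
    intro y
    rw [← ps_mulc]
    congr 1
    funext m
    exact Rop_apply w y m
  apply LH_ext
  rw [ContinuousLinearMap.mul_apply, ContinuousLinearMap.mul_apply, hF, hR, hR, hF, mul_assoc]

lemma IsM.comm_S {A : PowerSeries H} {F : LH →L[ℝ] LH} (hF : IsM A F) :
    F * QPaper.Sop = QPaper.Sop * F := by
  have h1 := hF.mul IsM.Sop
  rw [X_comm] at h1
  exact h1.uniq (IsM.Sop.mul hF)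

open ContinuousLinearMap in
lemma adj_mul (F G : LH →L[ℝ] LH) : adjoint (F * G) = adjoint G * adjoint F := adjoint_comp F G

lemma kv_mem (q : H) (hq : ‖q‖ < 1) (μ : H) : Summable fun m => ‖star q ^ m * μ‖ ^ 2 := by
  have : ∀ m : ℕ, ‖star q ^ m * μ‖ ^ 2 = ‖μ‖ ^ 2 * (‖q‖ ^ 2) ^ m := by
    intro m
    rw [norm_mul, norm_pow, norm_star]; ring
  simp_rw [this]
  apply Summable.mul_left
  exact summable_geometric_of_lt_one (sq_nonneg _) (by nlinarith [norm_nonneg q])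

open Classical in
/-- the reproducing kernel vectors -/
def kv (q : H) (μ : H) : LH :=
  if hq : ‖q‖ < 1 then ⟨fun m => star q ^ m * μ, LH_mem (kv_mem q hq μ)⟩ else 0

lemma kv_apply (q : H) (hq : ‖q‖ < 1) (μ : H) (m : ℕ) : (kv q μ : ℕ → H) m = star q ^ m * μ := by
  unfold kv
  rw [dif_pos hq]

lemma IsM.bdd {a : ℕ → H} {F : LH →L[ℝ] LH} (hF : IsM (ps a) F) : ∃ x : LH, (x : ℕ → H) = a := by
  refine ⟨F (lp.single 2 0 1), ps_inj ?_⟩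
  rw [hF]
  have : ps ((lp.single 2 0 1 : LH) : ℕ → H) = 1 := by
    ext1 j
    rw [ps_coeff, single_apply, PowerSeries.coeff_one]
  rw [this, mul_one]

lemma summ_of_LH (x : LH) (q : H) (hq : ‖q‖ < 1) (j : ℕ) : Summable fun m => q ^ m * x (m + j) := by
  apply Summable.of_norm_bounded (g := fun m => ‖x‖ * ‖q‖ ^ m)
  · exact (summable_geometric_of_lt_one (norm_nonneg _) hq).mul_left _
  · intro m
    rw [norm_mul, norm_pow, mul_comm]
    exact mul_le_mul_of_nonneg_right (lp.norm_apply_le_norm (by norm_num) x _) (by positivity)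

open ContinuousLinearMap in
lemma adj_kv {a : ℕ → H} {F : LH →L[ℝ] LH} (hF : IsM (ps a) F) (q : H) (hq : ‖q‖ < 1) (μ : H) :
    adjoint F (kv q μ) = Cop (star (evalC a q)) (kv q μ) := by
  obtain ⟨x, hx⟩ := hF.bdd
  have hs : Summable fun m => q ^ m * a m := by
    have := summ_of_LH x q hq 0
    simpa [hx] using this
  apply Subtype.ext
  funext l
  apply ext_inner_left ℝ
  intro ν
  refine (inner_single l ν _).trans ?_
  rw [adjoint_inner_right, lp.inner_eq_tsum, Cop_apply, kv_apply q hq]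
  have hFl : ∀ m, (F (lp.single 2 l ν) : ℕ → H) m = if l ≤ m then a (m - l) * ν else 0 := by
    intro m
    rw [← ps_coeff (F _), hF]
    have : ps ((lp.single 2 l ν : LH) : ℕ → H) = PowerSeries.C ν * PowerSeries.X ^ l := by
      ext1 j
      rw [ps_coeff, single_apply, PowerSeries.coeff_C_mul, PowerSeries.coeff_X_pow]
      simp
    rw [this, ← mul_assoc, PowerSeries.coeff_mul_X_pow', PowerSeries.coeff_mul_C, ps_coeff]
  simp_rw [hFl, kv_apply q hq]
  rw [← Function.Injective.tsum_eq (add_left_injective l)]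
  · simp only [Nat.add_sub_cancel, Nat.le_add_left, if_true]
    have h1 : ∀ j, inner ℝ (a j * ν) (star q ^ (j + l) * μ)
        = inner ℝ (star (ν * star μ * q ^ l)) (q ^ j * a j) := by
      intro j
      rw [Quaternion.inner_def, Quaternion.inner_def, ← star_mul, Quaternion.re_star, mul_assoc (q ^ j),
        re_mul_comm (q ^ j), star_mul, star_pow, star_star, add_comm j l, pow_add]
      simp only [mul_assoc]
    simp_rw [h1]
    have h2 := (innerSL ℝ (star (ν * star μ * q ^ l))).map_tsum hs
    simp only [innerSL_apply_apply] at h2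
    rw [← h2]
    change inner ℝ _ (evalC a q) = _
    rw [Quaternion.inner_def, Quaternion.inner_def, ← star_mul, Quaternion.re_star, re_mul_comm]
    simp only [star_mul, star_pow, star_star, mul_assoc]
  · intro m hm
    by_cases h : l ≤ m
    · exact ⟨m - l, by simp [h]⟩
    · simp [h] at hm


open ContinuousLinearMap in
lemma bl_norm (F : LH →L[ℝ] LH) (w : H) (z : LH) :
    ‖(1 - Cop (star w) * F) z‖ ^ 2 - ‖(F - Cop w) z‖ ^ 2
      = (1 - ‖w‖ ^ 2) * (‖z‖ ^ 2 - ‖F z‖ ^ 2) := by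
  have h1 : (1 - Cop (star w) * F) z = z - Cop (star w) (F z) := by simp
  have h2 : (F - Cop w) z = F z - Cop w z := by simp
  rw [h1, h2, @norm_sub_sq ℝ, @norm_sub_sq ℝ, Cop_norm, Cop_norm, ← Cop_adj, adjoint_inner_right,
    real_inner_comm, norm_star]
  simp only [RCLike.re_to_real]
  ring

lemma bl_exists (F : LH →L[ℝ] LH) (hF : ∀ x, ‖F x‖ ≤ ‖x‖) (w : H) (hw : ‖w‖ < 1) :
    ∃ G Ui : LH →L[ℝ] LH, G * (1 - Cop (star w) * F) = F - Cop w ∧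
      (1 - Cop (star w) * F) * Ui = 1 ∧ Ui * (1 - Cop (star w) * F) = 1 ∧ ∀ x, ‖G x‖ ≤ ‖x‖ := by
  have hn : ‖Cop (star w) * F‖ < 1 := by
    refine lt_of_le_of_lt (ContinuousLinearMap.opNorm_le_bound _ (norm_nonneg w) ?_) hw
    intro x
    rw [ContinuousLinearMap.mul_apply, Cop_norm, norm_star]
    exact mul_le_mul_of_nonneg_left (hF x) (norm_nonneg _)
  obtain ⟨u, hu⟩ := isUnit_one_sub_of_norm_lt_one (R := LH →L[ℝ] LH) (x := Cop (star w) * F) hn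
  have e1 : (1 - Cop (star w) * F) * (↑u⁻¹ : LH →L[ℝ] LH) = 1 := by rw [← hu]; simp
  have e2 : (↑u⁻¹ : LH →L[ℝ] LH) * (1 - Cop (star w) * F) = 1 := by rw [← hu]; simp
  refine ⟨(F - Cop w) * ↑u⁻¹, ↑u⁻¹, ?_, e1, e2, ?_⟩
  · rw [mul_assoc, e2, mul_one]
  · intro x
    have := bl_norm F w ((↑u⁻¹ : LH →L[ℝ] LH) x)
    rw [← ContinuousLinearMap.mul_apply, e1, ← ContinuousLinearMap.mul_apply] at this
    have h3 := hF ((↑u⁻¹ : LH →L[ℝ] LH) x)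
    have h4 : 0 ≤ (1 - ‖w‖ ^ 2) * (‖(↑u⁻¹ : LH →L[ℝ] LH) x‖ ^ 2 - ‖F ((↑u⁻¹ : LH →L[ℝ] LH) x)‖ ^ 2) := by
      apply mul_nonneg
      · nlinarith [norm_nonneg w]
      · nlinarith [norm_nonneg (F ((↑u⁻¹ : LH →L[ℝ] LH) x))]
    apply (sq_le_sq₀ (norm_nonneg _) (norm_nonneg _)).1
    simp only [ContinuousLinearMap.one_apply] at this
    linarith

lemma IsM.of_right {B E K : PowerSeries H} {G U Ui N : LH →L[ℝ] LH} (hE : IsM E U) (hK : IsM K N)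
    (h : B * E = K) (hG : G * U = N) (hU : U * Ui = 1) : IsM B G := by
  intro x
  have hx : x = U (Ui x) := by rw [← ContinuousLinearMap.mul_apply, hU]; rfl
  rw [hx, ← ContinuousLinearMap.mul_apply G, hG, hK, hE, ← mul_assoc, h]

lemma kv_of_rec (p : H) (hp : ‖p‖ < 1) (x : LH) (h : ∀ m, (x : ℕ → H) (m + 1) = star p * x m) :
    x = kv p (x 0) := by
  apply Subtype.ext
  funext m
  rw [kv_apply p hp]
  induction m with
  | zero => simp
  | succ m ih => rw [h, ih, pow_succ', mul_assoc]

open ContinuousLinearMap in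
lemma bl_adj {F G : LH →L[ℝ] LH} {w : H} (h : G * (1 - Cop (star w) * F) = F - Cop w) (x : LH) :
    adjoint G x - adjoint F (Cop w (adjoint G x)) = adjoint F x - Cop (star w) x := by
  have := congrArg adjoint h
  rw [adj_mul, map_sub, map_sub, adj_mul, Cop_adj, Cop_adj, star_star] at this
  have h2 := congrArg (fun T => T x) this
  have h1 : adjoint (1 : LH →L[ℝ] LH) = 1 := adjoint_id
  simpa [h1] using h2

open ContinuousLinearMap in
lemma bl_inj {F Ui : LH →L[ℝ] LH} {w : H} (h : (1 - Cop (star w) * F) * Ui = 1) (x : LH)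
    (hx : x - adjoint F (Cop w x) = 0) : x = 0 := by
  have := congrArg adjoint h
  have h1 : adjoint (1 : LH →L[ℝ] LH) = 1 := adjoint_id
  rw [adj_mul, map_sub, adj_mul, Cop_adj, star_star, h1] at this
  have h2 := congrArg (fun T => T x) this
  have h3 : (1 - adjoint F * Cop w) x = 0 := by simpa using hx
  rw [ContinuousLinearMap.mul_apply] at h2
  simp only [h3] at h2
  simpa using h2.symm

open ContinuousLinearMap in
lemma exists_M (p : H) (hp : ‖p‖ < 1) : ∃ M : LH →L[ℝ] LH, IsM (ps (mobiusC p)) M ∧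
    (∀ x, ‖M x‖ = ‖x‖) ∧ (∀ μ, adjoint M (kv p μ) = 0) ∧
    (∀ x, adjoint M x = 0 → x = kv p (x 0)) ∧
    (∀ x, adjoint M x - adjoint Sop (Cop p (adjoint M x)) = adjoint Sop x - Cop (star p) x) := by
  obtain ⟨M, Ui, h1, h2, h3, h4⟩ := bl_exists Sop (fun x => (Sop_norm x).le) p hp
  refine ⟨M, ?_, ?_, ?_, ?_, bl_adj h1⟩
  · refine IsM.of_right (IsM.one.sub ((IsM.Cop (star p)).mul IsM.Sop)) (IsM.Sop.sub (IsM.Cop p)) ?_ h1 h2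
    rw [← ps_oneMinus, ← ps_qMinus, mob_mul_oneMinus]
  · intro x
    have hx : x = (1 - Cop (star p) * Sop) (Ui x) := by rw [← ContinuousLinearMap.mul_apply, h2]; rfl
    have := bl_norm Sop p (Ui x)
    rw [Sop_norm, sub_self, mul_zero, sub_eq_zero, sq_eq_sq₀ (norm_nonneg _) (norm_nonneg _), ← hx,
      ← h1, ContinuousLinearMap.mul_apply, ← hx] at this
    exact this.symm
  · intro μ
    apply bl_inj h2
    rw [bl_adj h1]
    apply Subtype.ext
    funext m
    change (adjoint Sop (kv p μ) : ℕ → H) m - (Cop (star p) (kv p μ) : ℕ → H) m = 0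
    rw [Sop_adj, Cop_apply, kv_apply p hp, kv_apply p hp, pow_succ', mul_assoc, sub_self]
  · intro x hx
    apply kv_of_rec p hp
    intro m
    have := bl_adj h1 x
    rw [hx] at this
    simp only [map_zero, sub_self] at this
    have h5 := congrArg (fun y : LH => (y : ℕ → H) m) this
    change 0 = (adjoint Sop x : ℕ → H) m - (Cop (star p) x : ℕ → H) m at h5
    rw [Sop_adj, Cop_apply] at h5
    exact sub_eq_zero.1 h5.symm

/-- contractive multipliers -/
def Schur (a : ℕ → H) : Prop := ∃ F, IsM (ps a) F ∧ ∀ x, ‖F x‖ ≤ ‖x‖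

lemma SelfMap.schur {a : ℕ → H} (ha : SelfMap a) : Schur a := by
  obtain ⟨F, h1, h2⟩ := IsM_of_contr a 1 (by norm_num) (by
    intro N x; rw [one_pow, one_mul]; exact lc a ha N x)
  exact ⟨F, h1, by simpa using h2⟩

lemma IsM.single0 {a : ℕ → H} {F : LH →L[ℝ] LH} (hF : IsM (ps a) F) :
    (F (lp.single 2 0 1) : ℕ → H) = a := by
  refine ps_inj ?_
  rw [hF]
  have : ps ((lp.single 2 0 1 : LH) : ℕ → H) = 1 := by
    ext1 j
    rw [ps_coeff, single_apply, PowerSeries.coeff_one]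
  rw [this, mul_one]

lemma schur_sum {a : ℕ → H} {F : LH →L[ℝ] LH} (hF : IsM (ps a) F) (hc : ∀ x, ‖F x‖ ≤ ‖x‖) (N : ℕ) :
    ∑ m ∈ Finset.range N, ‖a m‖ ^ 2 ≤ 1 := by
  have h1 := hc (lp.single 2 0 1)
  have h2 : ‖(lp.single 2 0 1 : LH)‖ = 1 := by
    rw [lp.norm_single (by norm_num)]; simp
  rw [h2] at h1
  have h3 := LH_norm_sq (F (lp.single 2 0 1))
  have h4 := (LH_summable (F (lp.single 2 0 1))).sum_le_tsum (Finset.range N) (fun _ _ => sq_nonneg _)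
  rw [← h3, hF.single0] at h4
  nlinarith [norm_nonneg (F (lp.single 2 0 1))]

lemma schur_zero {a : ℕ → H} {F : LH →L[ℝ] LH} (hF : IsM (ps a) F) (hc : ∀ x, ‖F x‖ ≤ ‖x‖) :
    ‖a 0‖ ≤ 1 := by
  have := schur_sum hF hc 1
  simp at this
  exact this

lemma schur_const {a : ℕ → H} {F : LH →L[ℝ] LH} (hF : IsM (ps a) F) (hc : ∀ x, ‖F x‖ ≤ ‖x‖)
    (h0 : 1 ≤ ‖a 0‖) : a = fun m => if m = 0 then a 0 else 0 := by
  funext m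
  rcases m with _ | m
  · simp
  · have := schur_sum hF hc (m + 2)
    rw [Finset.sum_range_succ, Finset.sum_range_succ'] at this
    have h2 : 0 ≤ ∑ k ∈ Finset.range m, ‖a (k + 1)‖ ^ 2 := Finset.sum_nonneg fun _ _ => sq_nonneg _
    have h3 : ‖a (m + 1)‖ ^ 2 ≤ 0 := by nlinarith
    have h4 : ‖a (m + 1)‖ = 0 := by
      have := norm_nonneg (a (m + 1))
      nlinarith
    simpa using h4

open ContinuousLinearMap in
lemma adj_le {F : LH →L[ℝ] LH} (hc : ∀ x, ‖F x‖ ≤ ‖x‖) (x : LH) : ‖adjoint F x‖ ≤ ‖x‖ := by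
  have h1 : ‖F‖ ≤ 1 := opNorm_le_bound _ (by norm_num) (by simpa using hc)
  have h2 : ‖adjoint F‖ ≤ 1 := by rwa [LinearIsometryEquiv.norm_map]
  calc _ ≤ ‖adjoint F‖ * ‖x‖ := le_opNorm _ _
    _ ≤ 1 * ‖x‖ := by gcongr
    _ = _ := one_mul _

lemma kv_ne (q : H) (hq : ‖q‖ < 1) (μ : H) (hμ : μ ≠ 0) : kv q μ ≠ 0 := by
  intro h
  have := kv_apply q hq μ 0
  rw [h] at this
  simp at this
  exact hμ this.symm

lemma schur_le {a : ℕ → H} {F : LH →L[ℝ] LH} (hF : IsM (ps a) F) (hc : ∀ x, ‖F x‖ ≤ ‖x‖)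
    (q : H) (hq : ‖q‖ < 1) : ‖evalC a q‖ ≤ 1 := by
  have h1 := adj_le hc (kv q 1)
  rw [adj_kv hF q hq, Cop_norm, norm_star] at h1
  have h2 : 0 < ‖kv q 1‖ := norm_pos_iff.2 (kv_ne q hq 1 one_ne_zero)
  exact le_of_mul_le_mul_right (by simpa using h1) h2

open ContinuousLinearMap in
lemma norm_eq_adj {F : LH →L[ℝ] LH} (hc : ∀ x, ‖F x‖ ≤ ‖x‖) (x : LH) (h : ‖x‖ ≤ ‖adjoint F x‖) :
    F (adjoint F x) = x := by
  rw [← sub_eq_zero, ← norm_le_zero_iff]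
  have h1 := @norm_sub_sq ℝ _ _ _ _ (F (adjoint F x)) x
  rw [← adjoint_inner_right, real_inner_self_eq_norm_sq] at h1
  simp only [RCLike.re_to_real] at h1
  have h2 := hc (adjoint F x)
  have h3 := adj_le hc x
  have h4 : ‖F (adjoint F x) - x‖ ^ 2 ≤ 0 := by
    nlinarith [norm_nonneg x, norm_nonneg (F (adjoint F x)), norm_nonneg (adjoint F x)]
  nlinarith [norm_nonneg (F (adjoint F x) - x)]

lemma IsM.coord0 {a : ℕ → H} {F : LH →L[ℝ] LH} (hF : IsM (ps a) F) (x : LH) :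
    (F x : ℕ → H) 0 = a 0 * x 0 := by
  rw [← ps_coeff (F x), hF]
  simp [PowerSeries.coeff_mul, ps_coeff]

lemma schur_max {a : ℕ → H} {F : LH →L[ℝ] LH} (hF : IsM (ps a) F) (hc : ∀ x, ‖F x‖ ≤ ‖x‖)
    (q : H) (hq : ‖q‖ < 1) (h : 1 ≤ ‖evalC a q‖) :
    ‖a 0‖ = 1 ∧ a = fun m => if m = 0 then a 0 else 0 := by
  have e := adj_kv hF q hq 1
  have h1 : F (ContinuousLinearMap.adjoint F (kv q 1)) = kv q 1 := by
    apply norm_eq_adj hc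
    rw [e, Cop_norm, norm_star]
    nlinarith [norm_nonneg (kv q 1)]
  have h2 := hF.coord0 (ContinuousLinearMap.adjoint F (kv q 1))
  rw [h1, e, Cop_apply, kv_apply q hq] at h2
  have h3 := congrArg norm h2
  simp at h3
  have h4 := schur_le hF hc q hq
  have h5 := schur_zero hF hc
  have h6 : 1 ≤ ‖a 0‖ := by nlinarith [norm_nonneg (a 0)]
  exact ⟨le_antisymm h5 h6, schur_const hF hc h6⟩

open ContinuousLinearMap in
lemma iso_adj {M : LH →L[ℝ] LH} (h : ∀ x, ‖M x‖ = ‖x‖) (x : LH) : adjoint M (M x) = x := by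
  have := (norm_map_iff_adjoint_comp_self M).1 h
  exact congrArg (fun T => T x) this

lemma one_sub_ne {x y : H} (hx : ‖x‖ < 1) (hy : ‖y‖ ≤ 1) : 1 - x * y ≠ 0 := by
  intro h
  have h1 := congrArg norm (sub_eq_zero.1 h)
  rw [norm_mul, norm_one] at h1
  nlinarith [norm_nonneg x, norm_nonneg y]

lemma schur_bullet {a : ℕ → H} {F : LH →L[ℝ] LH} (hF : IsM (ps a) F) (hc : ∀ x, ‖F x‖ ≤ ‖x‖)
    (p : H) (hp : ‖p‖ < 1) (hw : ‖evalC a p‖ < 1) :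
    ps (bulletC (evalC a p) a) = ps (mobiusC p) * ps (hdqC a p) ∧
    ps (mobiusC p) * ps (hdqC a p) * (1 - PowerSeries.C (star (evalC a p)) * ps a)
      = ps a - PowerSeries.C (evalC a p) := by
  have h0 := schur_zero hF hc
  have hw' : ‖star (evalC a p)‖ < 1 := by rwa [norm_star]
  have h2 : 1 - star (evalC a p) * a 0 ≠ 0 := one_sub_ne hw' h0
  have h1 : 1 - a 0 * star (evalC a p) ≠ 0 := by
    intro h
    have h1 := congrArg norm (sub_eq_zero.1 h)
    rw [norm_mul, norm_one] at h1
    nlinarith [norm_nonneg (a 0), norm_nonneg (star (evalC a p))]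
  obtain ⟨x, hx⟩ := hF.bdd
  have hR := diffQuot_eq a p (by
    intro m
    have := summ_of_LH x p hp m
    rwa [hx] at this)
  refine ⟨hdq_bullet a p h1 h2 hR, ?_⟩
  rw [← ps_denC]
  exact hdq_eq a p h2 hR

open ContinuousLinearMap in
lemma step {a : ℕ → H} {F : LH →L[ℝ] LH} (hF : IsM (ps a) F) (hc : ∀ x, ‖F x‖ ≤ ‖x‖)
    (p : H) (hp : ‖p‖ < 1) (hw : ‖evalC a p‖ < 1) :
    ∃ G Hh Ui : LH →L[ℝ] LH, IsM (ps (mobiusC p) * ps (hdqC a p)) G ∧ IsM (ps (hdqC a p)) Hh ∧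
      G * (1 - Cop (star (evalC a p)) * F) = F - Cop (evalC a p) ∧
      (1 - Cop (star (evalC a p)) * F) * Ui = 1 ∧
      (∀ x, ‖G x‖ ≤ ‖x‖) ∧ (∀ x, ‖Hh x‖ ≤ ‖x‖) := by
  obtain ⟨G, Ui, h1, h2, h3, h4⟩ := bl_exists F hc (evalC a p) hw
  obtain ⟨M, m1, m2, m3, m4, m5⟩ := exists_M p hp
  have hG : IsM (ps (mobiusC p) * ps (hdqC a p)) G :=
    IsM.of_right (IsM.one.sub ((IsM.Cop _).mul hF)) (hF.sub (IsM.Cop _))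
      (schur_bullet hF hc p hp hw).2 h1 h2
  have hGk : ∀ μ, adjoint G (kv p μ) = 0 := by
    intro μ
    apply bl_inj h2
    rw [bl_adj h1, adj_kv hF p hp, sub_self]
  have hMG : ∀ x, M (adjoint M (G x)) = G x := by
    intro x
    set z := G x - M (adjoint M (G x)) with hz
    have hz0 : adjoint M z = 0 := by
      rw [hz, map_sub, iso_adj m2, sub_self]
    have hk := m4 z hz0
    have : inner ℝ z z = (0 : ℝ) := by
      nth_rewrite 2 [hz]
      rw [inner_sub_right, ← adjoint_inner_left, ← adjoint_inner_left, hz0, hk, hGk]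
      simp
    rw [inner_self_eq_zero] at this
    exact (sub_eq_zero.1 this).symm
  refine ⟨G, adjoint M * G, Ui, hG, ?_, h1, h2, h4, ?_⟩
  · intro x
    apply mul_left_cancel₀ (mob_ne_zero p)
    rw [← m1, ContinuousLinearMap.mul_apply, hMG, hG, mul_assoc]
  · intro x
    rw [ContinuousLinearMap.mul_apply]
    exact (adj_le (fun x => (m2 x).le) _).trans (h4 x)

/-- isometric multipliers with small defect space -/
def Df (k : ℕ) (a : ℕ → H) : Prop := ∃ F : LH →L[ℝ] LH, IsM (ps a) F ∧ (∀ x, ‖F x‖ = ‖x‖) ∧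
  Module.rank ℝ (LinearMap.ker (ContinuousLinearMap.adjoint F : LH →ₗ[ℝ] LH)) ≤ ((4 * k : ℕ) : Cardinal)

lemma Df.mono {k l : ℕ} {a : ℕ → H} (h : k ≤ l) (hD : Df k a) : Df l a := by
  obtain ⟨F, h1, h2, h3⟩ := hD
  refine ⟨F, h1, h2, h3.trans ?_⟩
  exact_mod_cast Nat.mul_le_mul_left 4 h

open ContinuousLinearMap in
lemma Df.const {a : ℕ → H} (h0 : ‖a 0‖ = 1) (h : a = fun m => if m = 0 then a 0 else 0) : Df 0 a := by
  refine ⟨Cop (a 0), ?_, ?_, ?_⟩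
  · rw [h, ps_const]; exact IsM.Cop _
  · intro x; rw [Cop_norm, h0, one_mul]
  · have : LinearMap.ker (adjoint (Cop (a 0)) : LH →ₗ[ℝ] LH) = ⊥ := by
      rw [LinearMap.ker_eq_bot']
      intro x hx
      have hx' : adjoint (Cop (a 0)) x = 0 := hx
      rw [Cop_adj] at hx'
      have := Cop_norm (star (a 0)) x
      rw [hx', norm_star, h0] at this
      simpa using this.symm
    rw [this]
    simp

open ContinuousLinearMap in
lemma rank_comp (A B : LH →L[ℝ] LH) :
    Module.rank ℝ (LinearMap.ker ((A * B : LH →L[ℝ] LH) : LH →ₗ[ℝ] LH)) ≤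
      Module.rank ℝ (LinearMap.ker (A : LH →ₗ[ℝ] LH)) + Module.rank ℝ (LinearMap.ker (B : LH →ₗ[ℝ] LH)) := by
  let f : LinearMap.ker ((A * B : LH →L[ℝ] LH) : LH →ₗ[ℝ] LH) →ₗ[ℝ] LinearMap.ker (A : LH →ₗ[ℝ] LH) :=
    ((B : LH →ₗ[ℝ] LH).comp (Submodule.subtype _)).codRestrict _ (fun x => x.2)
  rw [← LinearMap.rank_range_add_rank_ker f]
  apply add_le_add
  · exact Submodule.rank_le _
  · let g : LinearMap.ker f →ₗ[ℝ] LinearMap.ker (B : LH →ₗ[ℝ] LH) :=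
      ((Submodule.subtype _).comp (Submodule.subtype _)).codRestrict _ (fun x => by
        have := x.2
        rw [LinearMap.mem_ker] at this
        exact congrArg Subtype.val this)
    apply LinearMap.rank_le_of_injective g
    intro x y hxy
    apply Subtype.ext
    apply Subtype.ext
    exact congrArg (fun z : LinearMap.ker (B : LH →ₗ[ℝ] LH) => (z : LH)) hxy

open ContinuousLinearMap in
lemma rank_H : Module.rank ℝ H = (4 : ℕ) := by
  rw [← Module.finrank_eq_rank]
  exact_mod_cast QuaternionAlgebra.finrank_eq_four (-1 : ℝ) 0 (-1)

open ContinuousLinearMap in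
lemma rank_kerM {p : H} (hp : ‖p‖ < 1) {M : LH →L[ℝ] LH} 
    (m4 : ∀ x, adjoint M x = 0 → x = kv p (x 0)) :
    Module.rank ℝ (LinearMap.ker (adjoint M : LH →ₗ[ℝ] LH)) ≤ (4 : ℕ) := by
  rw [← rank_H]
  let g : LinearMap.ker (adjoint M : LH →ₗ[ℝ] LH) →ₗ[ℝ] H :=
    { toFun := fun x => (x : LH) 0
      map_add' := fun x y => rfl
      map_smul' := fun r x => rfl }
  apply LinearMap.rank_le_of_injective g
  intro x y hxy
  apply Subtype.ext
  rw [m4 x x.2, m4 y y.2]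
  exact congrArg (kv p) hxy

open ContinuousLinearMap in
lemma Df.step {k : ℕ} {a : ℕ → H} (ha : Schur a) (p : H) (hp : ‖p‖ < 1) (hw : ‖evalC a p‖ < 1)
    (hD : Df k (hdqC a p)) : Df (k + 1) a := by
  obtain ⟨F, hF, hc⟩ := ha
  obtain ⟨G, Hh, Ui, g1, g2, g3, g4, g5, g6⟩ := QPaper.step hF hc p hp hw
  obtain ⟨H', k1, k2, k3⟩ := hD
  obtain rfl := g2.uniq k1
  obtain ⟨M, m1, m2, m3, m4, m5⟩ := exists_M p hp
  obtain rfl := g1.uniq (m1.mul g2)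
  have hGi : ∀ x, ‖(M * Hh) x‖ = ‖x‖ := by
    intro x; rw [ContinuousLinearMap.mul_apply, m2, k2]
  have hFi : ∀ x, ‖F x‖ = ‖x‖ := by
    intro x
    have := bl_norm F (evalC a p) x
    rw [← g3, ContinuousLinearMap.mul_apply _ _ x, hGi, sub_self] at this
    have h1 : (1 - ‖evalC a p‖ ^ 2) ≠ 0 := by nlinarith [norm_nonneg (evalC a p)]
    have h2 := (mul_eq_zero.1 this.symm).resolve_left h1
    rw [sub_eq_zero, sq_eq_sq₀ (norm_nonneg _) (norm_nonneg _)] at h2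
    exact h2.symm
  refine ⟨F, hF, hFi, ?_⟩
  have hr : Module.rank ℝ (LinearMap.ker (adjoint (M * Hh) : LH →ₗ[ℝ] LH)) ≤ ((4 * (k + 1) : ℕ) : Cardinal) := by
    rw [adj_mul]
    refine (rank_comp _ _).trans ?_
    refine (add_le_add k3 (rank_kerM hp m4)).trans ?_
    exact_mod_cast le_of_eq (by ring)
  refine le_trans ?_ hr
  let T : LH →ₗ[ℝ] LH := ((1 - (M * Hh) * adjoint (M * Hh) : LH →L[ℝ] LH) : LH →ₗ[ℝ] LH)
  let g : LinearMap.ker (adjoint F : LH →ₗ[ℝ] LH) →ₗ[ℝ] LinearMap.ker (adjoint (M * Hh) : LH →ₗ[ℝ] LH) :=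
    (T.comp (Submodule.subtype _)).codRestrict _ (fun x => by
      rw [LinearMap.mem_ker]
      change adjoint (M * Hh) ((x : LH) - (M * Hh) (adjoint (M * Hh) x)) = 0
      rw [map_sub, iso_adj hGi, sub_self])
  apply LinearMap.rank_le_of_injective g
  rw [← LinearMap.ker_eq_bot, LinearMap.ker_eq_bot']
  intro x hx
  have hx1 : (x : LH) - (M * Hh) (adjoint (M * Hh) x) = 0 := congrArg Subtype.val hx
  have hx2 : adjoint F (x : LH) = 0 := x.2
  have hx3 : adjoint (M * Hh) (x : LH) = - Cop (star (evalC a p)) (x : LH) := by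
    rw [← sub_eq_zero]
    apply bl_inj g4
    have h1 := bl_adj g3 (x : LH)
    rw [hx2] at h1
    have h2 : Cop (evalC a p) (Cop (star (evalC a p)) (x : LH)) = (‖evalC a p‖ ^ 2) • (x : LH) := by
      apply Subtype.ext
      funext m
      rw [Cop_apply, Cop_apply, ← mul_assoc, Quaternion.self_mul_star, Quaternion.normSq_eq_norm_mul_self]
      change _ = (‖evalC a p‖ ^ 2) • (x : LH) m
      rw [← Quaternion.coe_mul_eq_smul, sq]
    have h3 : adjoint F (Cop (evalC a p) (Cop (star (evalC a p)) (x : LH))) = 0 := by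
      rw [h2, map_smul, hx2, smul_zero]
    rw [map_sub, map_sub, map_neg, map_neg, h3, neg_zero, sub_zero, sub_neg_eq_add, add_sub_right_comm, h1]
    simp
  have hn : ‖(x : LH)‖ = ‖evalC a p‖ * ‖(x : LH)‖ := by
    have := congrArg norm (sub_eq_zero.1 hx1)
    rwa [hGi, hx3, norm_neg, Cop_norm, norm_star] at this
  have : ‖(x : LH)‖ = 0 := by nlinarith [norm_nonneg (x : LH)]
  exact Subtype.ext (by simpa using this)

lemma eig_aux {V : Type*} [AddCommGroup V] [Module ℝ V] [FiniteDimensional ℝ V] [Nontrivial V]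
    (J T : V →ₗ[ℝ] V) (hJ : ∀ x, J (J x) = -x) (hc : ∀ x, T (J x) = J (T x)) :
    ∃ x : V, x ≠ 0 ∧ ∃ α β : ℝ, T x = α • x + β • J x := by
  let φ : ℂ →ₐ[ℝ] Module.End ℝ V := Complex.lift ⟨J, by ext x; exact hJ x⟩
  letI : Module ℂ V := Module.compHom V φ.toRingHom
  have hs : ∀ (z : ℂ) (x : V), z • x = z.re • x + z.im • J x := by
    intro z x
    change (φ z) x = _
    simp [φ, Complex.lift_apply, Complex.liftAux_apply, Module.algebraMap_end_apply]
  haveI : IsScalarTower ℝ ℂ V := by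
    refine ⟨fun r z x => ?_⟩
    rw [hs, hs]
    simp [mul_smul]
  haveI : FiniteDimensional ℂ V := Module.Finite.of_restrictScalars_finite ℝ ℂ V
  let Tc : V →ₗ[ℂ] V :=
    { toFun := T
      map_add' := T.map_add
      map_smul' := by
        intro z x
        simp only [RingHom.id_apply]
        rw [hs, hs, map_add, map_smul, map_smul, hc] }
  obtain ⟨z, hz⟩ := Module.End.exists_eigenvalue Tc
  obtain ⟨x, hx⟩ := hz.exists_hasEigenvector
  refine ⟨x, hx.2, z.re, z.im, ?_⟩
  rw [← hs]
  exact hx.apply_eq_smul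

open ContinuousLinearMap in
lemma adj_comm {A : PowerSeries H} {F : LH →L[ℝ] LH} (hF : IsM A F) (x : LH) (hx : adjoint F x = 0) :
    adjoint F (adjoint Sop x) = 0 ∧ ∀ w, adjoint F (Rop w x) = 0 := by
  constructor
  · have := congrArg adjoint hF.comm_S
    rw [adj_mul, adj_mul] at this
    have h2 := congrArg (fun T => T x) this
    simp only [ContinuousLinearMap.mul_apply] at h2
    rw [← h2, hx, map_zero]
  · intro w
    have := congrArg adjoint (hF.comm_R (star w))
    rw [adj_mul, adj_mul, Rop_adj, star_star] at this
    have h2 := congrArg (fun T => T x) this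
    simp only [ContinuousLinearMap.mul_apply] at h2
    rw [← h2, hx, map_zero]

/-- a unit imaginary quaternion -/
def qi : H := ⟨0, 1, 0, 0⟩

lemma qi_sq : qi * qi = -1 := by
  have h : qi * qi = QuaternionAlgebra.mk (-1) 0 0 0 := by
    unfold qi
    refine (QuaternionAlgebra.mk_mul_mk _ _ _ _ _ _ _ _).trans ?_
    simp
  rw [h]
  ext <;> simp [Quaternion.re_one] <;> rfl

open ContinuousLinearMap in
lemma exists_zero {a : ℕ → H} {F : LH →L[ℝ] LH} (hF : IsM (ps a) F)
    [FiniteDimensional ℝ (LinearMap.ker (adjoint F : LH →ₗ[ℝ] LH))]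
    [Nontrivial (LinearMap.ker (adjoint F : LH →ₗ[ℝ] LH))] :
    ∃ s : H, ‖s‖ < 1 ∧ evalC a s = 0 := by
  let J : LinearMap.ker (adjoint F : LH →ₗ[ℝ] LH) →ₗ[ℝ] LinearMap.ker (adjoint F : LH →ₗ[ℝ] LH) :=
    (Rop qi : LH →ₗ[ℝ] LH).restrict (fun x hx => (adj_comm hF x hx).2 qi)
  let T : LinearMap.ker (adjoint F : LH →ₗ[ℝ] LH) →ₗ[ℝ] LinearMap.ker (adjoint F : LH →ₗ[ℝ] LH) :=
    (adjoint Sop : LH →ₗ[ℝ] LH).restrict (fun x hx => (adj_comm hF x hx).1)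
  obtain ⟨x, hx0, α, β, hx⟩ := eig_aux J T (by
    intro x
    apply Subtype.ext
    apply Subtype.ext
    funext m
    change (Rop qi (Rop qi (x : LH)) : ℕ → H) m = - ((x : LH) : ℕ → H) m
    rw [Rop_apply, Rop_apply, mul_assoc, qi_sq, mul_neg, mul_one]) (by
    intro x
    apply Subtype.ext
    apply Subtype.ext
    funext m
    change (adjoint Sop (Rop qi (x : LH)) : ℕ → H) m = (Rop qi (adjoint Sop (x : LH)) : ℕ → H) m
    rw [Rop_apply, Sop_adj, Rop_apply, Sop_adj])
  have hrec : ∀ m, ((x : LH) : ℕ → H) (m + 1) = ((x : LH) : ℕ → H) m * ((α : H) + β * qi) := by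
    intro m
    have h1 := congrArg (fun y : LinearMap.ker (adjoint F : LH →ₗ[ℝ] LH) => ((y : LH) : ℕ → H) m) hx
    change (adjoint Sop (x : LH) : ℕ → H) m = α • ((x : LH) : ℕ → H) m + β • (Rop qi (x : LH) : ℕ → H) m at h1
    rw [Sop_adj, Rop_apply] at h1
    rw [h1, mul_add, ← Quaternion.coe_mul_eq_smul, ← Quaternion.coe_mul_eq_smul,
      Quaternion.coe_commutes, ← mul_assoc, Quaternion.coe_commutes, mul_assoc]
  set z : H := (α : H) + β * qi with hz
  have hpow : ∀ m, ((x : LH) : ℕ → H) m = ((x : LH) : ℕ → H) 0 * z ^ m := by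
    intro m
    induction m with
    | zero => simp
    | succ m ih => rw [hrec, ih, pow_succ, mul_assoc]
  set c := ((x : LH) : ℕ → H) 0 with hcdef
  have hc : c ≠ 0 := by
    intro h
    apply hx0
    apply Subtype.ext
    apply Subtype.ext
    funext m
    rw [hpow, h, zero_mul]
    rfl
  have hz1 : ‖z‖ < 1 := by
    have hs := (LH_summable (x : LH)).tendsto_atTop_zero
    by_contra hcon
    push Not at hcon
    have hle : ∀ m, ‖c‖ ^ 2 ≤ ‖((x : LH) : ℕ → H) m‖ ^ 2 := by
      intro m
      rw [hpow, norm_mul, norm_pow]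
      have : 1 ≤ ‖z‖ ^ m := one_le_pow₀ hcon
      have hc0 := norm_nonneg c
      apply pow_le_pow_left₀ hc0
      nlinarith
    have := ge_of_tendsto' hs hle
    have hcp : 0 < ‖c‖ := norm_pos_iff.2 hc
    nlinarith
  have hns : ‖star (c * z * c⁻¹)‖ < 1 := by
    have hcp : ‖c‖ ≠ 0 := norm_ne_zero_iff.2 hc
    rw [norm_star, norm_mul, norm_mul, norm_inv, mul_comm, ← mul_assoc, inv_mul_cancel₀ hcp, one_mul]
    exact hz1
  refine ⟨star (c * z * c⁻¹), hns, ?_⟩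
  have hk : (x : LH) = kv (star (c * z * c⁻¹)) c := by
    apply kv_of_rec _ hns
    intro m
    rw [star_star]
    induction m with
    | zero => rw [hrec]; change c * z = c * z * c⁻¹ * c; rw [mul_assoc, inv_mul_cancel₀ hc, mul_one]
    | succ m ih => rw [hrec (m + 1), ih, mul_assoc (c * z * c⁻¹), ← hrec m, ih]
  have h1 := adj_kv hF _ hns c
  rw [← hk] at h1
  have h2 : adjoint F (x : LH) = 0 := x.2
  rw [h2] at h1
  have h3 := congrArg norm h1
  rw [Cop_norm, norm_star, norm_zero] at h3
  have h4 : ‖(x : LH)‖ ≠ 0 := by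
    rw [norm_ne_zero_iff]
    intro h
    exact hx0 (Subtype.ext h)
  have := (mul_eq_zero.1 h3.symm).resolve_right h4
  simpa using this

/-- kernel vectors as a linear map -/
def kvL (q : H) (hq : ‖q‖ < 1) : H →ₗ[ℝ] LH :=
  { toFun := kv q
    map_add' := by
      intro x y
      apply Subtype.ext
      funext m
      change (kv q (x + y) : ℕ → H) m = (kv q x : ℕ → H) m + (kv q y : ℕ → H) m
      rw [kv_apply q hq, kv_apply q hq, kv_apply q hq, mul_add]
    map_smul' := by
      intro r x
      apply Subtype.ext
      funext m
      change (kv q (r • x) : ℕ → H) m = r • (kv q x : ℕ → H) m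
      rw [kv_apply q hq, kv_apply q hq, mul_smul_comm] }

open ContinuousLinearMap in
lemma const_of_ker {a : ℕ → H} {F : LH →L[ℝ] LH} (hF : IsM (ps a) F) (hi : ∀ x, ‖F x‖ = ‖x‖)
    (hk : LinearMap.ker (adjoint F : LH →ₗ[ℝ] LH) = ⊥) : IsBlaschke a 0 := by
  have hc : ∀ x, ‖F x‖ ≤ ‖x‖ := fun x => (hi x).le
  have h1 : ∀ x, F (adjoint F x) = x := by
    intro x
    rw [← sub_eq_zero]
    apply LinearMap.ker_eq_bot'.1 hk
    change adjoint F (F (adjoint F x) - x) = 0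
    rw [map_sub, iso_adj hi, sub_self]
  have h2 := hF.coord0 (adjoint F (lp.single 2 0 1))
  rw [h1, single_apply, if_pos rfl] at h2
  have h3 : ‖(adjoint F (lp.single 2 0 1) : ℕ → H) 0‖ ≤ 1 := by
    refine (lp.norm_apply_le_norm (by norm_num) _ _).trans ((adj_le hc _).trans ?_)
    rw [lp.norm_single (by norm_num)]; simp
  have h4 := congrArg norm h2
  rw [norm_one, norm_mul] at h4
  have h5 := schur_zero hF hc
  have h6 : 1 ≤ ‖a 0‖ := by nlinarith [norm_nonneg (a 0)]
  refine ⟨[], a 0, rfl, by simp, le_antisymm h5 h6, ?_⟩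
  conv_lhs => rw [schur_const hF hc h6]
  funext m
  simp [blaschkeListC]

open ContinuousLinearMap in
lemma Df.red {k : ℕ} {a : ℕ → H} {F : LH →L[ℝ] LH} (hF : IsM (ps a) F) (hi : ∀ x, ‖F x‖ = ‖x‖)
    (hr : Module.rank ℝ (LinearMap.ker (adjoint F : LH →ₗ[ℝ] LH)) ≤ ((4 * (k + 1) : ℕ) : Cardinal))
    (s : H) (hs : ‖s‖ < 1) (h0 : evalC a s = 0) :
    ∃ h, ps a = ps (mobiusC s) * ps h ∧ Df k h := by
  have hc : ∀ x, ‖F x‖ ≤ ‖x‖ := fun x => (hi x).le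
  have hw : ‖evalC a s‖ < 1 := by rw [h0]; simp
  have e := (schur_bullet hF hc s hs hw).2
  rw [h0] at e
  simp only [star_zero, map_zero, zero_mul, sub_zero, mul_one] at e
  obtain ⟨G, Hh, Ui, g1, g2, g3, g4, g5, g6⟩ := QPaper.step hF hc s hs hw
  obtain ⟨M, m1, m2, m3, m4, m5⟩ := exists_M s hs
  have hFM : F = M * Hh := hF.uniq (by rw [← e]; exact m1.mul g2)
  refine ⟨_, e.symm, Hh, g2, ?_, ?_⟩
  · intro x
    rw [← hi x, hFM, ContinuousLinearMap.mul_apply, m2]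
  · have hA : ∀ x, adjoint F x = adjoint Hh (adjoint M x) := by
      intro x; rw [hFM, adj_mul]; rfl
    let f : LinearMap.ker (adjoint F : LH →ₗ[ℝ] LH) →ₗ[ℝ] LinearMap.ker (adjoint Hh : LH →ₗ[ℝ] LH) :=
      ((adjoint M : LH →ₗ[ℝ] LH).comp (Submodule.subtype _)).codRestrict _ (fun x => by
        have h2 : adjoint F (x : LH) = 0 := x.2
        rw [LinearMap.mem_ker]
        change adjoint Hh (adjoint M (x : LH)) = 0
        rw [← hA, h2])
    have hsurj : Function.Surjective f := by
      intro y
      have hy : adjoint Hh (y : LH) = 0 := y.2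
      refine ⟨⟨M y, ?_⟩, ?_⟩
      · rw [LinearMap.mem_ker]
        change adjoint F (M y) = 0
        rw [hA, iso_adj m2, hy]
      · apply Subtype.ext
        exact iso_adj m2 y
    have h1 := LinearMap.rank_range_add_rank_ker f
    rw [rank_range_of_surjective f hsurj] at h1
    let g : H →ₗ[ℝ] LinearMap.ker f :=
      ((kvL s hs).codRestrict (LinearMap.ker (adjoint F : LH →ₗ[ℝ] LH)) (fun μ => by
        rw [LinearMap.mem_ker]
        change adjoint F (kv s μ) = 0
        rw [hA, m3, map_zero])).codRestrict _ (fun μ => by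
        rw [LinearMap.mem_ker]
        apply Subtype.ext
        exact m3 μ)
    have hg : Function.Injective g := by
      intro x y hxy
      have h2 : kv s x = kv s y :=
        congrArg (fun z : LinearMap.ker f => ((z : LinearMap.ker (adjoint F : LH →ₗ[ℝ] LH)) : LH)) hxy
      have h3 := congrArg (fun z : LH => (z : ℕ → H) 0) h2
      simp only [kv_apply s hs] at h3
      simpa using h3
    have h2 := LinearMap.rank_le_of_injective g hg
    rw [rank_H] at h2
    have h3 : Module.rank ℝ (LinearMap.ker (adjoint Hh : LH →ₗ[ℝ] LH)) + (4 : ℕ) ≤ ((4 * k : ℕ) : Cardinal) + (4 : ℕ) := by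
      refine (add_le_add le_rfl h2).trans ?_
      rw [h1]
      refine hr.trans ?_
      exact_mod_cast le_of_eq (by ring)
    exact (Cardinal.add_nat_le_add_nat_iff 4).1 h3

open ContinuousLinearMap in
lemma Df.blaschke (k : ℕ) : ∀ a : ℕ → H, Df k a → ∃ κ, κ ≤ k ∧ IsBlaschke a κ := by
  induction k with
  | zero =>
    rintro a ⟨F, hF, hi, hr⟩
    refine ⟨0, le_rfl, const_of_ker hF hi ?_⟩
    rw [← Submodule.rank_eq_zero]
    simpa using hr
  | succ k ih =>
    rintro a ⟨F, hF, hi, hr⟩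
    by_cases hk : LinearMap.ker (adjoint F : LH →ₗ[ℝ] LH) = ⊥
    · exact ⟨0, by omega, const_of_ker hF hi hk⟩
    · haveI : Nontrivial (LinearMap.ker (adjoint F : LH →ₗ[ℝ] LH)) :=
        (Submodule.nontrivial_iff_ne_bot).2 hk
      haveI : FiniteDimensional ℝ (LinearMap.ker (adjoint F : LH →ₗ[ℝ] LH)) :=
        Module.rank_lt_aleph0_iff.1 (lt_of_le_of_lt hr Cardinal.natCast_lt_aleph0)
      obtain ⟨s, hs, h0⟩ := exists_zero hF
      obtain ⟨h, e, hD⟩ := Df.red hF hi hr s hs h0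
      obtain ⟨κ, hκ, ts, u, t1, t2, t3, t4⟩ := ih h hD
      refine ⟨κ + 1, by omega, s :: ts, u, by simp [t1], ?_, t3, ?_⟩
      · intro t ht
        rcases List.mem_cons.1 ht with rfl | ht
        · exact hs
        · exact t2 t ht
      · apply ps_inj
        rw [e, t4, ps_mulc, ps_mulc, blaschkeListC, ps_starMul, mul_assoc]

open ContinuousLinearMap in
lemma mob_eval_eq (p q : H) (hp : ‖p‖ < 1) (hq : ‖q‖ < 1) :
    evalC (mobiusC p) q - q * evalC (mobiusC p) q * star p = q - p := by
  obtain ⟨M, m1, m2, m3, m4, m5⟩ := exists_M p hp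
  have h := m5 (kv q 1)
  rw [adj_kv m1 q hq] at h
  have h5 := congrArg (fun y : LH => (y : ℕ → H) 0) h
  change (Cop _ (kv q 1) : ℕ → H) 0 - (adjoint Sop _ : ℕ → H) 0
    = (adjoint Sop (kv q 1) : ℕ → H) 0 - (Cop (star p) (kv q 1) : ℕ → H) 0 at h5
  rw [Sop_adj, Sop_adj, Cop_apply, Cop_apply, Cop_apply, Cop_apply, kv_apply q hq, kv_apply q hq] at h5
  have h6 := congrArg star h5
  simpa [mul_assoc] using h6

lemma mobEval_eq (p q : H) (hp : ‖p‖ < 1) (hq : ‖q‖ < 1) :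
    mobiusEval p q - q * mobiusEval p q * star p = q - p := by
  have hD : 1 - q * p ≠ 0 := one_sub_ne hq hp.le
  have hT : ‖mobiusT p q‖ < 1 := by
    unfold mobiusT
    rw [norm_conj q _ hD]; exact hq
  have hE : 1 - mobiusT p q * star p ≠ 0 := one_sub_ne hT (by rw [norm_star]; exact hp.le)
  have hv : (1 - mobiusT p q * star p) * mobiusEval p q = mobiusT p q - p := by
    unfold mobiusEval mobiusM
    rw [← mul_assoc, mul_inv_cancel₀ hE, one_mul]
  set v := mobiusEval p q
  set D := 1 - q * p with hDdef
  have hDT : D * mobiusT p q = q * D := by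
    unfold mobiusT
    rw [← mul_assoc, ← mul_assoc, mul_inv_cancel₀ hD, one_mul]
  have hN : D - q * D * star p = D * (1 - mobiusT p q * star p) := by
    rw [mul_sub D, mul_one, ← mul_assoc, hDT]
  have hN0 : D - q * D * star p ≠ 0 := by rw [hN]; exact mul_ne_zero hD hE
  have hNv : (D - q * D * star p) * v = q * D - D * p := by
    rw [hN, mul_assoc, hv, mul_sub, hDT]
  have hpp : p * star p = ((‖p‖ ^ 2 : ℝ) : H) := by
    rw [Quaternion.self_mul_star, Quaternion.normSq_eq_norm_mul_self, sq]
  have hpp' : star p * p = ((‖p‖ ^ 2 : ℝ) : H) := by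
    rw [Quaternion.star_mul_self, Quaternion.normSq_eq_norm_mul_self, sq]
  have hps : p + star p = ((2 * p.re : ℝ) : H) := by
    rw [Quaternion.self_add_star, Quaternion.coe_mul]; rfl
  have hNe : D - q * D * star p = 1 - q * ((2 * p.re : ℝ) : H) + q * q * ((‖p‖ ^ 2 : ℝ) : H) := by
    rw [← hpp, ← hps, hDdef]; noncomm_ring
  have hNq : (D - q * D * star p) * q = q * (D - q * D * star p) := by
    rw [hNe, add_mul, mul_add, sub_mul, mul_sub, mul_assoc q _ q, Quaternion.coe_commutes,
      mul_assoc (q * q) _ q, Quaternion.coe_commutes]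
    noncomm_ring
  apply mul_left_cancel₀ hN0
  calc (D - q * D * star p) * (v - q * v * star p)
      = (D - q * D * star p) * v - ((D - q * D * star p) * q) * v * star p := by noncomm_ring
    _ = (q * D - D * p) - q * (q * D - D * p) * star p := by
        rw [hNq, mul_assoc q _ v, hNv]
    _ = q * D - D * p - q * q * D * star p + q * D * (p * star p) := by noncomm_ring
    _ = q * D - D * p - q * q * D * star p + q * D * (star p * p) := by rw [hpp, hpp']
    _ = q * (D - q * D * star p) - (D - q * D * star p) * p := by noncomm_ring
    _ = _ := by rw [← hNq, ← mul_sub (D - q * D * star p)]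

lemma mob_eval (p q : H) (hp : ‖p‖ < 1) (hq : ‖q‖ < 1) :
    evalC (mobiusC p) q = mobiusEval p q := by
  have h1 := mob_eval_eq p q hp hq
  have h2 := mobEval_eq p q hp hq
  rw [← sub_eq_zero]
  set u := evalC (mobiusC p) q
  set v := mobiusEval p q
  have h3 : u - v = q * (u - v) * star p := by
    have : u - v - q * (u - v) * star p = (u - q * u * star p) - (v - q * v * star p) := by noncomm_ring
    rw [← sub_eq_zero, this, h1, h2, sub_self]
  have h4 := congrArg norm h3
  rw [norm_mul, norm_mul, norm_star] at h4
  have h5 : ‖q‖ * ‖p‖ < 1 := by nlinarith [norm_nonneg q, norm_nonneg p]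
  have h6 : ‖u - v‖ = 0 := by nlinarith [norm_nonneg (u - v)]
  simpa using h6

open ContinuousLinearMap in
lemma eval_mul {g h : ℕ → H} {Hh : LH →L[ℝ] LH} (hH : IsM (ps h) Hh) (p q : H) (hp : ‖p‖ < 1) (hq : ‖q‖ < 1)
    (e : ps g = ps (mobiusC p) * ps h) :
    ∃ q', ‖q'‖ < 1 ∧ evalC g q = mobiusEval p q * evalC h q' := by
  obtain ⟨M, m1, m2, m3, m4, m5⟩ := exists_M p hp
  have hg : IsM (ps g) (M * Hh) := by rw [e]; exact m1.mul hH
  have h1 := adj_kv hg q hq 1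
  rw [adj_mul, ContinuousLinearMap.mul_apply, adj_kv m1 q hq, mob_eval p q hp hq] at h1
  set u := mobiusEval p q
  by_cases hu : u = 0
  · refine ⟨q, hq, ?_⟩
    have h2 := congrArg (fun y : LH => (y : ℕ → H) 0) h1
    have h3 : Cop (star u) (kv q 1) = 0 := by
      rw [← norm_eq_zero, Cop_norm, hu]; simp
    simp only [h3, map_zero, Cop_apply, kv_apply q hq] at h2
    have h4 : star (evalC g q) = 0 := by simpa using h2.symm
    rw [hu, zero_mul]
    simpa using h4
  · have hsu : star u ≠ 0 := by simpa using hu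
    have hq' : ‖u⁻¹ * q * u‖ < 1 := by rw [norm_conj q u hu]; exact hq
    refine ⟨u⁻¹ * q * u, hq', ?_⟩
    have hk : Cop (star u) (kv q 1) = kv (u⁻¹ * q * u) (star u) := by
      apply Subtype.ext
      funext m
      rw [Cop_apply, kv_apply q hq, kv_apply _ hq']
      have h3 := conj_pow_mul (star (u⁻¹ * q * u)) (star u) 1 hsu m
      rw [mul_one] at h3
      rw [h3]
      congr 3
      rw [star_mul, star_mul, star_inv₀, ← mul_assoc, inv_mul_cancel₀ hsu, one_mul, mul_assoc,
        inv_mul_cancel₀ hsu, mul_one]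
    rw [hk, adj_kv hH _ hq'] at h1
    have h2 := congrArg (fun y : LH => (y : ℕ → H) 0) h1
    simp only [Cop_apply, kv_apply q hq, kv_apply _ hq'] at h2
    have h4 := congrArg star h2
    simpa using h4.symm

lemma strict_of_not {k : ℕ} {a : ℕ → H} (ha : Schur a) (hn : ¬ Df k a) (q : H) (hq : ‖q‖ < 1) :
    ‖evalC a q‖ < 1 := by
  obtain ⟨F, hF, hc⟩ := ha
  by_contra h
  push Not at h
  obtain ⟨h1, h2⟩ := schur_max hF hc q hq h
  exact hn ((Df.const h1 h2).mono (Nat.zero_le _))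

lemma Schur.hdq {a : ℕ → H} (ha : Schur a) (p : H) (hp : ‖p‖ < 1) (hw : ‖evalC a p‖ < 1) :
    Schur (hdqC a p) := by
  obtain ⟨F, hF, hc⟩ := ha
  obtain ⟨G, Hh, Ui, g1, g2, g3, g4, g5, g6⟩ := QPaper.step hF hc p hp hw
  exact ⟨Hh, g2, g6⟩

lemma chain (l : List H) : ∀ a : ℕ → H, Schur a → ¬ Df l.length a → (∀ p ∈ l, ‖p‖ < 1) →
    Schur (ihdqC a l) ∧ (¬ Df 0 (ihdqC a l)) ∧ ∀ k, Df k (ihdqC a l) → Df (l.length + k) a := by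
  induction l with
  | nil =>
    intro a ha hn _
    refine ⟨ha, hn, fun k hk => ?_⟩
    simpa [ihdqC] using hk
  | cons p l ih =>
    intro a ha hn hl
    have hp : ‖p‖ < 1 := hl p (by simp)
    have hw := strict_of_not ha hn p hp
    have hn' : ¬ Df l.length (hdqC a p) := fun h => hn (Df.step ha p hp hw h)
    obtain ⟨h1, h2, h3⟩ := ih (hdqC a p) (ha.hdq p hp hw) hn' (fun t ht => hl t (by simp [ht]))
    refine ⟨h1, h2, fun k hk => ?_⟩
    have := Df.step ha p hp hw (h3 k hk)
    rw [List.length_cons]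
    have e : l.length + 1 + k = l.length + k + 1 := by ring
    rw [e]
    exact this

theorem main' (n : ℕ) (_hn : 1 ≤ n) (a : ℕ → H) (ha : SelfMap a)
    (hnot : ∀ κ, κ ≤ n → ¬ IsBlaschke a κ)
    (ps : Fin n → H) (hps : ∀ i, ‖ps i‖ < 1) (p : H) (hp : ‖p‖ < 1) :
    (∀ q : H, ‖q‖ < 1 →
      ‖evalC (bulletC (evalC (ihdqC a (List.ofFn ps)) p) (ihdqC a (List.ofFn ps))) q‖ ≤
        ‖mobiusEval p q‖) ∧
    (¬ IsBlaschke a (n + 1) → ∀ q : H, ‖q‖ < 1 → q ≠ p →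
      ‖evalC (bulletC (evalC (ihdqC a (List.ofFn ps)) p) (ihdqC a (List.ofFn ps))) q‖ <
        ‖mobiusEval p q‖) := by
  have hlen : (List.ofFn ps).length = n := List.length_ofFn
  have hnD : ¬ Df (List.ofFn ps).length a := by
    intro h
    obtain ⟨κ, hκ, hB⟩ := Df.blaschke _ a h
    exact hnot κ (by omega) hB
  obtain ⟨h1, h2, h3⟩ := chain (List.ofFn ps) a ha.schur hnD (by
    intro t ht
    obtain ⟨i, rfl⟩ := (List.mem_ofFn' _ _).1 ht
    exact hps i)
  set h := ihdqC a (List.ofFn ps)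
  have hw := strict_of_not h1 h2 p hp
  have h1' := h1
  obtain ⟨F, hF, hc⟩ := h1'
  obtain ⟨Hh, g2, g6⟩ := h1.hdq p hp hw
  have e := (schur_bullet hF hc p hp hw).1
  constructor
  · intro q hq
    obtain ⟨q', hq', he⟩ := eval_mul g2 p q hp hq e
    rw [he, norm_mul]
    have := schur_le g2 g6 q' hq'
    nlinarith [norm_nonneg (mobiusEval p q)]
  · intro hB q hq hqp
    obtain ⟨q', hq', he⟩ := eval_mul g2 p q hp hq e
    have hnB : ¬ Df 0 (hdqC h p) := by
      intro hD
      obtain ⟨κ, hκ, hB'⟩ := Df.blaschke _ a (h3 _ (Df.step h1 p hp hw hD))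
      rw [hlen] at hκ
      rcases Nat.lt_or_ge n κ with hlt | hge
      · have : κ = n + 1 := by omega
        exact hB (this ▸ hB')
      · exact hnot κ hge hB'
    have hs := strict_of_not ⟨Hh, g2, g6⟩ hnB q' hq'
    have hu : mobiusEval p q ≠ 0 := by
      intro h0
      have := mobEval_eq p q hp hq
      rw [h0] at this
      apply hqp
      rw [← sub_eq_zero, ← this]
      simp
    have hu' : 0 < ‖mobiusEval p q‖ := norm_pos_iff.2 hu
    rw [he, norm_mul]
    nlinarith

/-- Multipoint Schwarz–Pick Lemma: if `f` is a slice regular self-map of `𝔹`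
which is not a regular Blaschke product of degree `≤ n`, then
`|(ℳ_{f^{⟨n⟩}(p)} ∙ f^{⟨n⟩})(q)| ≤ |ℳ_p(q)|` on `𝔹`, strictly for `q ≠ p`
unless `f` is a regular Blaschke product of degree `n+1`. -/
theorem multipoint_schwarzPick (n : ℕ) (hn : 1 ≤ n) (a : ℕ → H) (ha : SelfMap a)
    (hnot : ∀ κ, κ ≤ n → ¬ IsBlaschke a κ)
    (ps : Fin n → H) (hps : ∀ i, ‖ps i‖ < 1) (p : H) (hp : ‖p‖ < 1) :
    (∀ q : H, ‖q‖ < 1 →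
      ‖evalC (bulletC (evalC (ihdqC a (List.ofFn ps)) p) (ihdqC a (List.ofFn ps))) q‖ ≤
        ‖mobiusEval p q‖) ∧
    (¬ IsBlaschke a (n + 1) → ∀ q : H, ‖q‖ < 1 → q ≠ p →
      ‖evalC (bulletC (evalC (ihdqC a (List.ofFn ps)) p) (ihdqC a (List.ofFn ps))) q‖ <
        ‖mobiusEval p q‖) := by
  exact main' n hn a ha hnot ps hps p hp

end QPaper
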